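/- Call an arc (s_δ, t_δ) of the spine of a triangulation T ordered if s_δ < t_δ. For every ℓ with 0 ≤ ℓ ≤ n, the number of triangulations T of P whose spine has exactly ℓ ordered arcs (and hence n−ℓ non-ordered arcs) equals the Narayana number (1/(n+1))·C(n+1, ℓ)·C(n+1, ℓ+1), where C(·,·) denotes the binomial coefficient. In particular this number does not depend on the choice of the partition of [n+1] into U and D. -/

import Mathlib

attribute [local instance] Classical.propDecidable

noncomputable section

namespace Spines

/-- Position of vertex `v ∈ {0,…,n+2}` in the counterclockwise boundary cyclic order:
`0`, then the elements of `D` in increasing order, then `n+2`, then the elements of `U`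
in decreasing order. -/
def pos (n : ℕ) (D U : Finset ℕ) (v : ℕ) : ℕ :=
  if v = 0 then 0
  else if v = n + 2 then D.card + 1
  else if v ∈ D then 1 + (D.filter (fun d => d < v)).card
  else D.card + 2 + (U.filter (fun u => v < u)).card

/-- Cyclic distance from `a` to `v` in counterclockwise direction. -/
def relpos (n : ℕ) (D U : Finset ℕ) (a v : ℕ) : ℕ :=
  (pos n D U v + (n + 3) - pos n D U a) % (n + 3)

/-- `v` lies strictly inside the counterclockwise boundary arc from `a` to `b`. -/
def StrictBetween (n : ℕ) (D U : Finset ℕ) (a b v : ℕ) : Prop :=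
  v ≤ n + 2 ∧ 0 < relpos n D U a v ∧ relpos n D U a v < relpos n D U a b

/-- A diagonal, encoded as an ordered pair `(a,b)` with `a < b ≤ n+2`. -/
def IsDiag (n : ℕ) (δ : ℕ × ℕ) : Prop := δ.1 < δ.2 ∧ δ.2 ≤ n + 2

/-- A boundary edge: the endpoints are adjacent in the cyclic order. -/
def IsBoundaryEdge (n : ℕ) (D U : Finset ℕ) (δ : ℕ × ℕ) : Prop :=
  IsDiag n δ ∧ (relpos n D U δ.1 δ.2 = 1 ∨ relpos n D U δ.2 δ.1 = 1)

/-- An internal diagonal. -/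
def IsInternalDiag (n : ℕ) (D U : Finset ℕ) (δ : ℕ × ℕ) : Prop :=
  IsDiag n δ ∧ ¬ IsBoundaryEdge n D U δ

/-- Two diagonals cross: the four endpoints are pairwise distinct and exactly one
endpoint of the second lies strictly inside each of the two arcs determined by the first. -/
def Cross (n : ℕ) (D U : Finset ℕ) (δ δ' : ℕ × ℕ) : Prop :=
  δ.1 ≠ δ.2 ∧ δ'.1 ≠ δ'.2 ∧ δ.1 ≠ δ'.1 ∧ δ.1 ≠ δ'.2 ∧ δ.2 ≠ δ'.1 ∧ δ.2 ≠ δ'.2 ∧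
  ((StrictBetween n D U δ.1 δ.2 δ'.1 ∧ StrictBetween n D U δ.2 δ.1 δ'.2) ∨
   (StrictBetween n D U δ.1 δ.2 δ'.2 ∧ StrictBetween n D U δ.2 δ.1 δ'.1))

/-- A triangulation: a maximal set of pairwise non-crossing internal diagonals. -/
def IsTriangulation (n : ℕ) (D U : Finset ℕ) (T : Finset (ℕ × ℕ)) : Prop :=
  (∀ δ ∈ T, IsInternalDiag n D U δ) ∧
  (∀ δ ∈ T, ∀ δ' ∈ T, ¬ Cross n D U δ δ') ∧
  (∀ δ, IsInternalDiag n D U δ → δ ∉ T → ∃ δ' ∈ T, Cross n D U δ δ')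

/-- `a` and `b` (with `a < b`) are joined by a diagonal of `T` or a boundary edge. -/
def EdgeOf (n : ℕ) (D U : Finset ℕ) (T : Finset (ℕ × ℕ)) (a b : ℕ) : Prop :=
  (a, b) ∈ T ∨ IsBoundaryEdge n D U (a, b)

/-- `{i,j,k}` with `i<j<k` is a triangle of the triangulation `T`. -/
def IsTriangleOf (n : ℕ) (D U : Finset ℕ) (T : Finset (ℕ × ℕ)) (i j k : ℕ) : Prop :=
  i < j ∧ j < k ∧ k ≤ n + 2 ∧
    EdgeOf n D U T i j ∧ EdgeOf n D U T j k ∧ EdgeOf n D U T i k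

/-- `Bel δ`: labels in `[n+1]` strictly inside the ccw arc from `δ.1` to `δ.2`,
together with the endpoints of `δ` lying in `U`. -/
def Bel (n : ℕ) (D U : Finset ℕ) (δ : ℕ × ℕ) : Finset ℕ :=
  (Finset.Icc 1 (n + 1)).filter
    (fun j => StrictBetween n D U δ.1 δ.2 j ∨ (j ∈ U ∧ (j = δ.1 ∨ j = δ.2)))

def bel (n : ℕ) (D U : Finset ℕ) (δ : ℕ × ℕ) : ℕ := (Bel n D U δ).card

def Abo (n : ℕ) (D U : Finset ℕ) (δ : ℕ × ℕ) : Finset ℕ :=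
  Finset.Icc 1 (n + 1) \ Bel n D U δ

/-- The coordinates of the point `x(T)` associated to a triangulation `T`. -/
def xcoord (n : ℕ) (D U : Finset ℕ) (T : Finset (ℕ × ℕ)) (j : ℕ) : ℝ :=
  if h : ∃ p : ℕ × ℕ, IsTriangleOf n D U T p.1 j p.2 then
    if j ∈ D then
      ((bel n D U (h.choose.1, j) : ℝ) + 1) * ((bel n D U (j, h.choose.2) : ℝ) + 1)
    else
      ((n : ℝ) + 2) -
        (((n : ℝ) + 2) - (bel n D U (h.choose.1, j) : ℝ)) *
          (((n : ℝ) + 2) - (bel n D U (j, h.choose.2) : ℝ))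
  else 0

/-- Middle vertex of the triple `{a,b,c}` with `a < b` and `c ∉ {a,b}`. -/
def midOf (a b c : ℕ) : ℕ := if c < a then a else if c < b then c else b

/-- `c` is the third vertex of a triangle of `T` containing the diagonal `δ`. -/
def TriWith (n : ℕ) (D U : Finset ℕ) (T : Finset (ℕ × ℕ)) (δ : ℕ × ℕ) (c : ℕ) : Prop :=
  if c < δ.1 then IsTriangleOf n D U T c δ.1 δ.2
  else if c < δ.2 then IsTriangleOf n D U T δ.1 c δ.2
  else IsTriangleOf n D U T δ.1 δ.2 c

/-- `s_δ`: middle vertex of the triangle of `T` below `δ` (third vertex strictly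
inside the ccw arc from `δ.1` to `δ.2`). -/
def spineSrc (n : ℕ) (D U : Finset ℕ) (T : Finset (ℕ × ℕ)) (δ : ℕ × ℕ) : ℕ :=
  if h : ∃ c, StrictBetween n D U δ.1 δ.2 c ∧ TriWith n D U T δ c then
    midOf δ.1 δ.2 h.choose
  else 0

/-- `t_δ`: middle vertex of the triangle of `T` above `δ` (third vertex strictly
inside the ccw arc from `δ.2` to `δ.1`). -/
def spineTgt (n : ℕ) (D U : Finset ℕ) (T : Finset (ℕ × ℕ)) (δ : ℕ × ℕ) : ℕ :=
  if h : ∃ c, StrictBetween n D U δ.2 δ.1 c ∧ TriWith n D U T δ c then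
    midOf δ.1 δ.2 h.choose
  else 0

/-- `(p,q)` is an arc of the spine of `T`. -/
def SpineArc (n : ℕ) (D U : Finset ℕ) (T : Finset (ℕ × ℕ)) (p q : ℕ) : Prop :=
  ∃ δ ∈ T, spineSrc n D U T δ = p ∧ spineTgt n D U T δ = q

/-- The finite set of all triangulations of the polygon. -/
def allTri (n : ℕ) (D U : Finset ℕ) : Finset (Finset (ℕ × ℕ)) :=
  ((Finset.range (n + 3) ×ˢ Finset.range (n + 3)).filter
      (fun δ => IsInternalDiag n D U δ)).powerset.filter
    (fun T => IsTriangulation n D U T)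

end Spines

namespace Spines

/-- Number of triangulations of `P` whose spine has exactly `ℓ` ordered arcs
(arcs `(s_δ, t_δ)` with `s_δ < t_δ`). -/
def orderedArcCount (n : ℕ) (D U : Finset ℕ) (ℓ : ℕ) : ℕ :=
  ((allTri n D U).filter
    (fun T => (T.filter (fun δ => spineSrc n D U T δ < spineTgt n D U T δ)).card = ℓ)).card

set_option linter.unusedSimpArgs false

/-- `v` lies strictly below the diagonal joining `a < b`, where `u` tells the up labels. -/
def Below (u : ℕ → Prop) (a b v : ℕ) : Prop :=
  (v < a ∧ u a) ∨ (a < v ∧ v < b ∧ ¬ u v) ∨ (b < v ∧ u b)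

/-- `v` lies strictly above the diagonal joining `a < b`. -/
def Above (u : ℕ → Prop) (a b v : ℕ) : Prop :=
  (v < a ∧ ¬ u a) ∨ (a < v ∧ v < b ∧ u v) ∨ (b < v ∧ ¬ u b)

/-- All edges and diagonals of the polygon with vertex set `S`. -/
def pairs (S : Finset ℕ) : Finset (ℕ × ℕ) := (S ×ˢ S).filter (fun δ => δ.1 < δ.2)

/-- Crossing of diagonals expressed through `Below` and `Above`. -/
def Crs (u : ℕ → Prop) (δ δ' : ℕ × ℕ) : Prop :=
  (Below u δ.1 δ.2 δ'.1 ∧ Above u δ.1 δ.2 δ'.2) ∨ (Above u δ.1 δ.2 δ'.1 ∧ Below u δ.1 δ.2 δ'.2)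

theorem mem_pairs {S : Finset ℕ} {δ : ℕ × ℕ} :
    δ ∈ pairs S ↔ δ.1 ∈ S ∧ δ.2 ∈ S ∧ δ.1 < δ.2 := by
  simp [pairs, and_assoc]

/-- Maximal non-crossing sets of edges and diagonals (boundary edges included)
of the polygon with vertex set `S`. -/
def Tri (u : ℕ → Prop) (S : Finset ℕ) : Finset (Finset (ℕ × ℕ)) :=
  (pairs S).powerset.filter (fun E => ∀ δ ∈ pairs S, δ ∈ E ↔ ∀ δ' ∈ E, ¬ Crs u δ δ')

theorem mem_Tri {u : ℕ → Prop} {S : Finset ℕ} {E : Finset (ℕ × ℕ)} :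
    E ∈ Tri u S ↔ E ⊆ pairs S ∧ ∀ δ ∈ pairs S, δ ∈ E ↔ ∀ δ' ∈ E, ¬ Crs u δ δ' := by
  simp [Tri]

/-- `a` and `b` are joined by an element of `E`. -/
def Adj (E : Finset (ℕ × ℕ)) (a b : ℕ) : Prop := (a, b) ∈ E ∨ (b, a) ∈ E

theorem Adj.symm {E : Finset (ℕ × ℕ)} {a b : ℕ} (h : Adj E a b) : Adj E b a := Or.symm h

/-- The value `c` truncated to the interval with end points `δ.1` and `δ.2`. -/
def clamp (δ : ℕ × ℕ) (c : ℕ) : ℕ := max δ.1 (min c δ.2)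

/-- The arc of the spine attached to `δ` is ordered. -/
def Ordered (u : ℕ → Prop) (E : Finset (ℕ × ℕ)) (δ : ℕ × ℕ) : Prop :=
  ∃ s t, Below u δ.1 δ.2 s ∧ Above u δ.1 δ.2 t ∧ Adj E s δ.1 ∧ Adj E s δ.2 ∧
    Adj E t δ.1 ∧ Adj E t δ.2 ∧ clamp δ s < clamp δ t

/-- The number of ordered elements of `E`. -/
def ord (u : ℕ → Prop) (E : Finset (ℕ × ℕ)) : ℕ :=
  ∑ δ ∈ E, if Ordered u E δ then 1 else 0

/-- Two pairs of integers interleave. -/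
def Interleave (p q r s : ℤ) : Prop :=
  (((p < r ∧ r < q) ∨ (q < r ∧ r < p)) ∧ ((s < p ∧ s < q) ∨ (p < s ∧ q < s))) ∨
  (((p < s ∧ s < q) ∨ (q < s ∧ s < p)) ∧ ((r < p ∧ r < q) ∨ (p < r ∧ q < r)))

/-- `κ` lists the vertices of `S` along the boundary of the polygon. -/
structure IsKey (u : ℕ → Prop) (S : Finset ℕ) (κ : ℕ → ℤ) : Prop where
  inj : ∀ a ∈ S, ∀ b ∈ S, κ a = κ b → a = b
  crs_iff : ∀ a ∈ S, ∀ b ∈ S, ∀ c ∈ S, ∀ d ∈ S, a < b → c < d →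
    (Crs u (a, b) (c, d) ↔ Interleave (κ a) (κ b) (κ c) (κ d))

/-- The key starting at the second largest vertex `m` and ending at the largest vertex `M`. -/
def rootKey (u : ℕ → Prop) (m M v : ℕ) : ℤ :=
  if v = M then M else if (u v ↔ u m) then -(v : ℤ) else v

/-- The position of `v` on the boundary, cut open at the largest vertex. -/
def linKey (u : ℕ → Prop) (v : ℕ) : ℤ := if u v then -(v : ℤ) else v

/-- The key starting at `a` and going counterclockwise. -/
def ccwKey (u : ℕ → Prop) (K a v : ℕ) : ℤ :=
  linKey u v + if linKey u v < linKey u a then 2 * K + 1 else 0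

theorem rootKey_below {u : ℕ → Prop} {m M a b : ℕ} (hm : m < M)
    (ha : a = M ∨ a ≤ m) (hb : b = M ∨ b ≤ m) (hab : a < b) :
    (∀ v, v = M ∨ v ≤ m →
      (Below u a b v ↔ (rootKey u m M a < rootKey u m M v ∧ rootKey u m M v < rootKey u m M b) ∨
        (rootKey u m M b < rootKey u m M v ∧ rootKey u m M v < rootKey u m M a)) ∧
      (Above u a b v ↔ (rootKey u m M v < rootKey u m M a ∧ rootKey u m M v < rootKey u m M b) ∨
        (rootKey u m M a < rootKey u m M v ∧ rootKey u m M b < rootKey u m M v))) ∨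
    (∀ v, v = M ∨ v ≤ m →
      (Above u a b v ↔ (rootKey u m M a < rootKey u m M v ∧ rootKey u m M v < rootKey u m M b) ∨
        (rootKey u m M b < rootKey u m M v ∧ rootKey u m M v < rootKey u m M a)) ∧
      (Below u a b v ↔ (rootKey u m M v < rootKey u m M a ∧ rootKey u m M v < rootKey u m M b) ∨
        (rootKey u m M a < rootKey u m M v ∧ rootKey u m M b < rootKey u m M v))) := by
  have ha : a ≤ m := by omega
  have haM : a ≠ M := by omega
  by_cases hbM : b = M
  · subst hbM
    by_cases hum : u m
    · left
      intro v hv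
      unfold Below Above rootKey
      have hva : v = a → (u v ↔ u a) := by rintro rfl; rfl
      have hvb' : v = b → (u v ↔ u b) := by rintro rfl; rfl
      by_cases hua : u a <;> by_cases huv : u v <;> by_cases hvb : v = b <;>
        simp only [hum, hua, huv, hvb, haM, if_true, if_false, iff_true, not_true,
          not_false_eq_true, and_true, and_false, or_false, false_or, iff_self,
          iff_true, iff_false, true_iff, false_iff, imp_false, implies_true] at hva hvb' ⊢ <;> omega
    · right
      intro v hv
      unfold Below Above rootKey
      have hva : v = a → (u v ↔ u a) := by rintro rfl; rfl
      have hvb' : v = b → (u v ↔ u b) := by rintro rfl; rfl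
      by_cases hua : u a <;> by_cases huv : u v <;> by_cases hvb : v = b <;>
        simp only [hum, hua, huv, hvb, haM, if_true, if_false, iff_false, not_true,
          not_false_eq_true, and_true, and_false, or_false, false_or, iff_self,
          iff_true, iff_false, true_iff, false_iff, imp_false, implies_true] at hva hvb' ⊢ <;> omega
  · have hb : b ≤ m := by omega
    by_cases hub : u b
    · right
      intro v hv
      unfold Below Above rootKey
      have hva : v = a → (u v ↔ u a) := by rintro rfl; rfl
      have hvb' : v = b → (u v ↔ u b) := by rintro rfl; rfl
      by_cases hua : u a <;> by_cases huv : u v <;> by_cases hum : u m <;>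
        by_cases hvb : v = M <;>
        simp only [hum, hub, hua, huv, hvb, haM, hbM, if_true, if_false, iff_true, iff_false,
          not_true, not_false_eq_true, and_true, and_false, or_false, false_or, iff_self,
          iff_true, iff_false, true_iff, false_iff, imp_false, implies_true] at hva hvb' ⊢ <;> omega
    · left
      intro v hv
      unfold Below Above rootKey
      have hva : v = a → (u v ↔ u a) := by rintro rfl; rfl
      have hvb' : v = b → (u v ↔ u b) := by rintro rfl; rfl
      by_cases hua : u a <;> by_cases huv : u v <;> by_cases hum : u m <;>
        by_cases hvb : v = M <;>
        simp only [hum, hub, hua, huv, hvb, haM, hbM, if_true, if_false, iff_true, iff_false,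
          not_true, not_false_eq_true, and_true, and_false, or_false, false_or, iff_self,
          iff_true, iff_false, true_iff, false_iff, imp_false, implies_true] at hva hvb' ⊢ <;> omega

theorem isKey_of_orient {u : ℕ → Prop} {S : Finset ℕ} {κ : ℕ → ℤ}
    (inj : ∀ a ∈ S, ∀ b ∈ S, κ a = κ b → a = b)
    (h : ∀ a ∈ S, ∀ b ∈ S, a < b →
      (∀ v ∈ S,
        (Below u a b v ↔ (κ a < κ v ∧ κ v < κ b) ∨ (κ b < κ v ∧ κ v < κ a)) ∧
        (Above u a b v ↔ (κ v < κ a ∧ κ v < κ b) ∨ (κ a < κ v ∧ κ b < κ v))) ∨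
      (∀ v ∈ S,
        (Above u a b v ↔ (κ a < κ v ∧ κ v < κ b) ∨ (κ b < κ v ∧ κ v < κ a)) ∧
        (Below u a b v ↔ (κ v < κ a ∧ κ v < κ b) ∨ (κ a < κ v ∧ κ b < κ v)))) :
    IsKey u S κ := by
  refine ⟨inj, fun a ha b hb c hc d hd hab hcd => ?_⟩
  unfold Crs Interleave
  rcases h a ha b hb hab with h | h
  · simp only [(h c hc).1, (h c hc).2, (h d hd).1, (h d hd).2]
    tauto
  · simp only [(h c hc).1, (h c hc).2, (h d hd).1, (h d hd).2]
    tauto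

theorem isKey_rootKey {u : ℕ → Prop} {m M : ℕ} (hm : m < M) {S : Finset ℕ}
    (hS : ∀ v ∈ S, v = M ∨ v ≤ m) : IsKey u S (rootKey u m M) := by
  refine isKey_of_orient (fun a ha b hb h => ?_) (fun a ha b hb hab => ?_)
  · have := hS a ha
    have := hS b hb
    unfold rootKey at h
    split_ifs at h <;> omega
  · rcases rootKey_below hm (hS a ha) (hS b hb) hab with h | h
    · exact Or.inl fun v hv => h v (hS v hv)
    · exact Or.inr fun v hv => h v (hS v hv)

theorem linKey_down {u : ℕ → Prop} {a b v : ℕ} (hab : a < b) (hub : ¬ u b) :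
    (Below u a b v ↔ (linKey u a < linKey u v ∧ linKey u v < linKey u b) ∨
      (linKey u b < linKey u v ∧ linKey u v < linKey u a)) ∧
    (Above u a b v ↔ (linKey u v < linKey u a ∧ linKey u v < linKey u b) ∨
      (linKey u a < linKey u v ∧ linKey u b < linKey u v)) := by
  unfold Below Above linKey
  have hva : v = a → (u v ↔ u a) := by rintro rfl; rfl
  have hvb' : v = b → (u v ↔ u b) := by rintro rfl; rfl
  by_cases hua : u a <;> by_cases huv : u v <;>
    simp only [hub, hua, huv, if_true, if_false, not_true, not_false_eq_true, and_true, and_false,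
      or_false, false_or, iff_self, iff_true, iff_false, true_iff,
          false_iff, imp_false, implies_true] at hva hvb' ⊢ <;> omega

theorem linKey_up {u : ℕ → Prop} {a b v : ℕ} (hab : a < b) (hub : u b) :
    (Above u a b v ↔ (linKey u a < linKey u v ∧ linKey u v < linKey u b) ∨
      (linKey u b < linKey u v ∧ linKey u v < linKey u a)) ∧
    (Below u a b v ↔ (linKey u v < linKey u a ∧ linKey u v < linKey u b) ∨
      (linKey u a < linKey u v ∧ linKey u b < linKey u v)) := by
  unfold Below Above linKey
  have hva : v = a → (u v ↔ u a) := by rintro rfl; rfl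
  have hvb' : v = b → (u v ↔ u b) := by rintro rfl; rfl
  by_cases hua : u a <;> by_cases huv : u v <;>
    simp only [hub, hua, huv, if_true, if_false, not_true, not_false_eq_true, and_true, and_false,
      or_false, false_or, iff_self, iff_true, iff_false, true_iff,
          false_iff, imp_false, implies_true] at hva hvb' ⊢ <;> omega

theorem linKey_bound {u : ℕ → Prop} {K v : ℕ} (hv : v ≤ K) :
    -(K : ℤ) ≤ linKey u v ∧ linKey u v ≤ K := by
  unfold linKey; split_ifs <;> omega

theorem isKey_ccwKey {u : ℕ → Prop} {K a : ℕ} {S : Finset ℕ} (ha : a ∈ S)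
    (hS : ∀ v ∈ S, v ≤ K) : IsKey u S (ccwKey u K a) := by
  refine isKey_of_orient (fun x hx y hy h => ?_) (fun x hx y hy hxy => ?_)
  · have := hS a ha
    have := hS x hx
    have := hS y hy
    unfold ccwKey linKey at h
    split_ifs at h <;> omega
  · have ba := linKey_bound (u := u) (hS a ha)
    have bx := linKey_bound (u := u) (hS x hx)
    have bY := linKey_bound (u := u) (hS y hy)
    by_cases huy : u y <;> by_cases h1 : linKey u x < linKey u a <;>
      by_cases h2 : linKey u y < linKey u a
    all_goals
      first
      | refine Or.inl fun v hv => ?_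
        have bv := linKey_bound (u := u) (hS v hv)
        simp only [linKey_up, linKey_down, hxy, huy, ccwKey, h1, h2, if_true, if_false,
          not_false_eq_true]
        split_ifs <;> omega
      | refine Or.inr fun v hv => ?_
        have bv := linKey_bound (u := u) (hS v hv)
        simp only [linKey_up, linKey_down, hxy, huy, ccwKey, h1, h2, if_true, if_false,
          not_false_eq_true]
        split_ifs <;> omega

theorem below_iff_ccwKey {u : ℕ → Prop} {K a b v : ℕ} (hab : a < b) (hb : b ≤ K) (hv : v ≤ K) :
    Below u a b v ↔ ccwKey u K a a < ccwKey u K a v ∧ ccwKey u K a v < ccwKey u K a b := by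
  unfold Below ccwKey linKey
  have hva : v = a → (u v ↔ u a) := by rintro rfl; rfl
  have hvb' : v = b → (u v ↔ u b) := by rintro rfl; rfl
  by_cases hua : u a <;> by_cases huv : u v <;> by_cases hub : u b <;>
    simp only [hub, hua, huv, if_true, if_false, not_true, not_false_eq_true, and_true, and_false,
      or_false, false_or, iff_self, iff_true, iff_false, true_iff,
          false_iff, imp_false, implies_true] at hva hvb' ⊢ <;> split_ifs <;> omega

theorem above_iff_ccwKey {u : ℕ → Prop} {K a b v : ℕ} (hab : a < b) (hb : b ≤ K) (hv : v ≤ K) :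
    Above u a b v ↔ ccwKey u K a b < ccwKey u K a v := by
  unfold Above ccwKey linKey
  have hva : v = a → (u v ↔ u a) := by rintro rfl; rfl
  have hvb' : v = b → (u v ↔ u b) := by rintro rfl; rfl
  by_cases hua : u a <;> by_cases huv : u v <;> by_cases hub : u b <;>
    simp only [hub, hua, huv, if_true, if_false, not_true, not_false_eq_true, and_true, and_false,
      or_false, false_or, iff_self, iff_true, iff_false, true_iff,
          false_iff, imp_false, implies_true] at hva hvb' ⊢ <;> split_ifs <;> omega

/-- Non-crossing and maximality of the edge set `E`, read off a key. -/
theorem noncross {u : ℕ → Prop} {S : Finset ℕ} {κ : ℕ → ℤ} {E : Finset (ℕ × ℕ)}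
    (hk : IsKey u S κ) (hE : E ∈ Tri u S) {a b c d : ℕ}
    (hab : κ a < κ b) (hbc : κ b < κ c) (hcd : κ c < κ d) (hac : Adj E a c) : ¬ Adj E b d := by
  intro hbd
  rw [mem_Tri] at hE
  rcases hac with h1 | h1 <;> rcases hbd with h2 | h2
  all_goals
    have m1 := mem_pairs.1 (hE.1 h1)
    have m2 := mem_pairs.1 (hE.1 h2)
    refine (hE.2 _ (hE.1 h1)).1 h1 _ h2
      ((hk.crs_iff _ m1.1 _ m1.2.1 _ m2.1 _ m2.2.1 m1.2.2 m2.2.2).2 ?_)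
    simp only [Interleave]
    omega

theorem Adj.mem_left {u : ℕ → Prop} {S : Finset ℕ} {E : Finset (ℕ × ℕ)} (hE : E ∈ Tri u S)
    {a b : ℕ} (h : Adj E a b) : a ∈ S := by
  rcases h with h | h
  · exact (mem_pairs.1 ((mem_Tri.1 hE).1 h)).1
  · exact (mem_pairs.1 ((mem_Tri.1 hE).1 h)).2.1

theorem adj_or_cross {u : ℕ → Prop} {S : Finset ℕ} {κ : ℕ → ℤ} {E : Finset (ℕ × ℕ)}
    (hk : IsKey u S κ) (hE : E ∈ Tri u S) {a c : ℕ} (ha : a ∈ S) (hc : c ∈ S)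
    (hac : κ a < κ c) :
    Adj E a c ∨ ∃ b d, Adj E b d ∧ κ a < κ b ∧ κ b < κ c ∧ (κ d < κ a ∨ κ c < κ d) := by
  have key : ∀ x ∈ S, ∀ y ∈ S, x < y → Adj E x y ∨
      ∃ b d, Adj E b d ∧ Interleave (κ x) (κ y) (κ b) (κ d) := by
    intro x hx y hy hxy
    by_cases h : (x, y) ∈ E
    · exact Or.inl (Or.inl h)
    · right
      have hp : (x, y) ∈ pairs S := mem_pairs.2 ⟨hx, hy, hxy⟩
      rw [(mem_Tri.1 hE).2 _ hp] at h
      push Not at h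
      obtain ⟨⟨b, d⟩, hbd, hcr⟩ := h
      have m := mem_pairs.1 ((mem_Tri.1 hE).1 hbd)
      exact ⟨b, d, Or.inl hbd, (hk.crs_iff _ hx _ hy _ m.1 _ m.2.1 hxy m.2.2).1 hcr⟩
  have key' : Adj E a c ∨ ∃ b d, Adj E b d ∧ Interleave (κ a) (κ c) (κ b) (κ d) := by
    rcases lt_trichotomy a c with h | h | h
    · exact key a ha c hc h
    · subst h; omega
    · rcases key c hc a ha h with h | ⟨b, d, h, h'⟩
      · exact Or.inl h.symm
      · refine Or.inr ⟨b, d, h, ?_⟩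
        unfold Interleave at *
        omega
  refine key'.imp id ?_
  rintro ⟨b, d, h, h'⟩
  unfold Interleave at h'
  by_cases hb : κ a < κ b ∧ κ b < κ c
  · exact ⟨b, d, h, hb.1, hb.2, by omega⟩
  · exact ⟨d, b, h.symm, by omega, by omega, by omega⟩

theorem exists_triangle {u : ℕ → Prop} {S : Finset ℕ} {κ : ℕ → ℤ} {E : Finset (ℕ × ℕ)}
    (hk : IsKey u S κ) (hE : E ∈ Tri u S) {a b x : ℕ} (hab : Adj E a b) (hx : x ∈ S)
    (hax : κ a < κ x) (hxb : κ x < κ b) :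
    ∃ c, κ a < κ c ∧ κ c < κ b ∧ Adj E a c ∧ Adj E c b := by
  have ha := hab.mem_left hE
  have hb := hab.symm.mem_left hE
  -- the neighbour of `a` along the boundary
  obtain ⟨y, hy, hymin⟩ := Finset.exists_min_image (S.filter fun v => κ a < κ v) κ
    ⟨x, by simp [hx, hax]⟩
  simp only [Finset.mem_filter] at hy hymin
  have hay : Adj E a y := by
    rcases adj_or_cross hk hE ha hy.1 hy.2 with h | ⟨p, q, h, h1, h2, -⟩
    · exact h
    · have := hymin p ⟨h.mem_left hE, h1⟩
      omega
  obtain ⟨c, hc, hcmax⟩ := Finset.exists_max_image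
    (S.filter fun v => κ a < κ v ∧ κ v < κ b ∧ Adj E a v) κ
    ⟨y, by
      simp only [Finset.mem_filter]
      exact ⟨hy.1, hy.2, by have := hymin x ⟨hx, hax⟩; omega, hay⟩⟩
  simp only [Finset.mem_filter] at hc hcmax
  refine ⟨c, hc.2.1, hc.2.2.1, hc.2.2.2, ?_⟩
  rcases adj_or_cross hk hE hc.1 hb hc.2.2.1 with h | ⟨p, q, h, h1, h2, h3⟩
  · exact h
  · exfalso
    have hp := h.mem_left hE
    rcases h3 with h3 | h3
    · rcases lt_trichotomy (κ a) (κ q) with h4 | h4 | h4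
      · exact noncross hk hE h4 h3 h1 hc.2.2.2 h.symm
      · have := hk.inj _ ha _ (h.symm.mem_left hE) h4
        subst this
        have := hcmax p ⟨hp, by omega, h2, h.symm⟩
        omega
      · exact noncross hk hE h4 (by omega) h2 h.symm hab
    · exact noncross hk hE (by omega) h2 h3 hab h

theorem triangle_unique {u : ℕ → Prop} {S : Finset ℕ} {κ : ℕ → ℤ} {E : Finset (ℕ × ℕ)}
    (hk : IsKey u S κ) (hE : E ∈ Tri u S) {a b c d : ℕ}
    (hac : κ a < κ c) (hcb : κ c < κ b) (had : κ a < κ d) (hdb : κ d < κ b)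
    (h1 : Adj E a c) (h2 : Adj E c b) (h3 : Adj E a d) (h4 : Adj E d b) : c = d := by
  rcases lt_trichotomy (κ c) (κ d) with h | h | h
  · exact absurd h2 (noncross hk hE hac h hdb h3)
  · exact hk.inj _ (h2.mem_left hE) _ (h4.mem_left hE) h
  · exact absurd h4 (noncross hk hE had h hcb h1)

/-- The vertices of `S` up to `c` in the order given by `κ`. -/
def lowPart (S : Finset ℕ) (κ : ℕ → ℤ) (c : ℕ) : Finset ℕ := S.filter fun v => κ v ≤ κ c

/-- The vertices of `S` from `c` on in the order given by `κ`. -/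
def highPart (S : Finset ℕ) (κ : ℕ → ℤ) (c : ℕ) : Finset ℕ := S.filter fun v => κ c ≤ κ v

theorem mem_lowPart {S : Finset ℕ} {κ : ℕ → ℤ} {c v : ℕ} :
    v ∈ lowPart S κ c ↔ v ∈ S ∧ κ v ≤ κ c := by simp [lowPart]

theorem mem_highPart {S : Finset ℕ} {κ : ℕ → ℤ} {c v : ℕ} :
    v ∈ highPart S κ c ↔ v ∈ S ∧ κ c ≤ κ v := by simp [highPart]

theorem lowPart_subset {S : Finset ℕ} {κ : ℕ → ℤ} {c : ℕ} : lowPart S κ c ⊆ S :=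
  Finset.filter_subset _ _

theorem highPart_subset {S : Finset ℕ} {κ : ℕ → ℤ} {c : ℕ} : highPart S κ c ⊆ S :=
  Finset.filter_subset _ _

theorem pairs_mono {S S' : Finset ℕ} (h : S ⊆ S') : pairs S ⊆ pairs S' := fun δ hδ => by
  rw [mem_pairs] at *
  exact ⟨h hδ.1, h hδ.2.1, hδ.2.2⟩

/-- A root edge `{m, M}` with first vertex `m` and last vertex `M` for the key `κ`, and a vertex
`c` in between. -/
structure Rooted (u : ℕ → Prop) (S : Finset ℕ) (κ : ℕ → ℤ) (m M c : ℕ) : Prop where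
  key : IsKey u S κ
  hm : m ∈ S
  hM : M ∈ S
  hc : c ∈ S
  cm : c < m
  mM : m < M
  first : ∀ v ∈ S, v ≠ m → κ m < κ v
  last : ∀ v ∈ S, v ≠ M → κ v < κ M

namespace Rooted

variable {u : ℕ → Prop} {S : Finset ℕ} {κ : ℕ → ℤ} {m M c : ℕ}

theorem crs_iff (h : Rooted u S κ m M c) {δ δ' : ℕ × ℕ} (hδ : δ ∈ pairs S) (hδ' : δ' ∈ pairs S) :
    Crs u δ δ' ↔ Interleave (κ δ.1) (κ δ.2) (κ δ'.1) (κ δ'.2) := by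
  rw [mem_pairs] at *
  exact h.key.crs_iff _ hδ.1 _ hδ.2.1 _ hδ'.1 _ hδ'.2.1 hδ.2.2 hδ'.2.2

theorem first' (h : Rooted u S κ m M c) {v : ℕ} (hv : v ∈ S) : κ m ≤ κ v := by
  rcases eq_or_ne v m with rfl | hv'
  · exact le_rfl
  · exact (h.first v hv hv').le

theorem last' (h : Rooted u S κ m M c) {v : ℕ} (hv : v ∈ S) : κ v ≤ κ M := by
  rcases eq_or_ne v M with rfl | hv'
  · exact le_rfl
  · exact (h.last v hv hv').le

theorem key_m_c (h : Rooted u S κ m M c) : κ m < κ c := h.first c h.hc h.cm.ne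

theorem key_c_M (h : Rooted u S κ m M c) : κ c < κ M := h.last c h.hc (h.cm.trans h.mM).ne

theorem m_mem_low (h : Rooted u S κ m M c) : m ∈ lowPart S κ c :=
  mem_lowPart.2 ⟨h.hm, h.key_m_c.le⟩

theorem c_mem_low (h : Rooted u S κ m M c) : c ∈ lowPart S κ c := mem_lowPart.2 ⟨h.hc, le_rfl⟩

theorem c_mem_high (h : Rooted u S κ m M c) : c ∈ highPart S κ c := mem_highPart.2 ⟨h.hc, le_rfl⟩

theorem M_mem_high (h : Rooted u S κ m M c) : M ∈ highPart S κ c :=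
  mem_highPart.2 ⟨h.hM, h.key_c_M.le⟩

theorem M_notMem_low (h : Rooted u S κ m M c) : M ∉ lowPart S κ c := fun h' => by
  have := (mem_lowPart.1 h').2
  have := h.key_c_M
  omega

theorem m_notMem_high (h : Rooted u S κ m M c) : m ∉ highPart S κ c := fun h' => by
  have := (mem_highPart.1 h').2
  have := h.key_m_c
  omega

theorem eq_c (h : Rooted u S κ m M c) {v : ℕ} (hv : v ∈ lowPart S κ c)
    (hv' : v ∈ highPart S κ c) : v = c := by
  rw [mem_lowPart] at hv
  rw [mem_highPart] at hv'
  exact h.key.inj _ hv.1 _ h.hc (by omega)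

theorem root_mem (h : Rooted u S κ m M c) : (m, M) ∈ pairs S := mem_pairs.2 ⟨h.hm, h.hM, h.mM⟩

theorem cm_mem_low (h : Rooted u S κ m M c) : (c, m) ∈ pairs (lowPart S κ c) :=
  mem_pairs.2 ⟨h.c_mem_low, h.m_mem_low, h.cm⟩

theorem cM_mem_high (h : Rooted u S κ m M c) : (c, M) ∈ pairs (highPart S κ c) :=
  mem_pairs.2 ⟨h.c_mem_high, h.M_mem_high, h.cm.trans h.mM⟩

theorem root_not_crs (h : Rooted u S κ m M c) {δ : ℕ × ℕ} (hδ : δ ∈ pairs S) :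
    ¬ Crs u (m, M) δ ∧ ¬ Crs u δ (m, M) := by
  rw [h.crs_iff hδ h.root_mem, h.crs_iff h.root_mem hδ]
  rw [mem_pairs] at hδ
  have h1 := h.first' hδ.1
  have h2 := h.first' hδ.2.1
  have h3 := h.last' hδ.1
  have h4 := h.last' hδ.2.1
  unfold Interleave
  simp only
  omega

theorem low_high_not_crs (h : Rooted u S κ m M c) {δ δ' : ℕ × ℕ}
    (hδ : δ ∈ pairs (lowPart S κ c)) (hδ' : δ' ∈ pairs (highPart S κ c)) :
    ¬ Crs u δ δ' ∧ ¬ Crs u δ' δ := by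
  have m1 := pairs_mono lowPart_subset hδ
  have m2 := pairs_mono highPart_subset hδ'
  rw [h.crs_iff m1 m2, h.crs_iff m2 m1]
  rw [mem_pairs, mem_lowPart, mem_lowPart] at hδ
  rw [mem_pairs, mem_highPart, mem_highPart] at hδ'
  unfold Interleave
  omega

theorem cm_not_crs (h : Rooted u S κ m M c) {δ : ℕ × ℕ} (hδ : δ ∈ pairs (lowPart S κ c)) :
    ¬ Crs u (c, m) δ := by
  rw [h.crs_iff (pairs_mono lowPart_subset h.cm_mem_low) (pairs_mono lowPart_subset hδ)]
  rw [mem_pairs, mem_lowPart, mem_lowPart] at hδ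
  have h1 := h.first' hδ.1.1
  have h2 := h.first' hδ.2.1.1
  unfold Interleave
  simp only
  omega

theorem cM_not_crs (h : Rooted u S κ m M c) {δ : ℕ × ℕ} (hδ : δ ∈ pairs (highPart S κ c)) :
    ¬ Crs u (c, M) δ := by
  rw [h.crs_iff (pairs_mono highPart_subset h.cM_mem_high) (pairs_mono highPart_subset hδ)]
  rw [mem_pairs, mem_highPart, mem_highPart] at hδ
  have h1 := h.last' hδ.1.1
  have h2 := h.last' hδ.2.1.1
  unfold Interleave
  simp only
  omega

theorem trichotomy (h : Rooted u S κ m M c) {δ : ℕ × ℕ} (hδ : δ ∈ pairs S)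
    (h1 : ¬ Crs u δ (c, m)) (h2 : ¬ Crs u δ (c, M)) :
    δ ∈ pairs (lowPart S κ c) ∨ δ ∈ pairs (highPart S κ c) ∨ δ = (m, M) := by
  rw [h.crs_iff hδ (pairs_mono lowPart_subset h.cm_mem_low)] at h1
  rw [h.crs_iff hδ (pairs_mono highPart_subset h.cM_mem_high)] at h2
  obtain ⟨x, y⟩ := δ
  rw [mem_pairs] at *
  simp only [mem_pairs, mem_lowPart, mem_highPart, Prod.mk.injEq] at *
  obtain ⟨hx, hy, hxy⟩ := hδ
  have a1 := h.first x hx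
  have a2 := h.first y hy
  have a3 := h.last x hx
  have a4 := h.last y hy
  have b1 := h.key_m_c
  have b2 := h.key_c_M
  have b3 := h.mM
  unfold Interleave at h1 h2
  by_cases e1 : x = m <;> by_cases e2 : y = M <;> by_cases e3 : y = m <;> by_cases e4 : x = M <;>
    simp only [hx, hy, hxy, e1, e2, e3, e4, h.hm, h.hM, true_and, and_true, ne_eq,
      not_true_eq_false, not_false_eq_true, forall_true_left, and_false, or_false, and_self,
      or_true] at * <;> omega

theorem glue (h : Rooted u S κ m M c) {E₁ E₂ : Finset (ℕ × ℕ)} (h₁ : E₁ ∈ Tri u (lowPart S κ c))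
    (h₂ : E₂ ∈ Tri u (highPart S κ c)) : insert (m, M) (E₁ ∪ E₂) ∈ Tri u S := by
  rw [mem_Tri] at h₁ h₂ ⊢
  have s₁ := h₁.1.trans (pairs_mono lowPart_subset)
  have s₂ := h₂.1.trans (pairs_mono highPart_subset)
  have hcm : (c, m) ∈ E₁ := (h₁.2 _ h.cm_mem_low).2 fun δ hδ => h.cm_not_crs (h₁.1 hδ)
  have hcM : (c, M) ∈ E₂ := (h₂.2 _ h.cM_mem_high).2 fun δ hδ => h.cM_not_crs (h₂.1 hδ)
  refine ⟨?_, fun δ hδ => ⟨fun hE δ' hδ' => ?_, fun hn => ?_⟩⟩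
  · intro δ hδ
    simp only [Finset.mem_insert, Finset.mem_union] at hδ
    rcases hδ with rfl | hδ | hδ
    · exact h.root_mem
    · exact s₁ hδ
    · exact s₂ hδ
  · simp only [Finset.mem_insert, Finset.mem_union] at hE hδ'
    rcases hδ' with rfl | h' | h'
    · exact (h.root_not_crs hδ).2
    · rcases hE with rfl | hE | hE
      · exact (h.root_not_crs (s₁ h')).1
      · exact (h₁.2 _ (h₁.1 hE)).1 hE _ h'
      · exact (h.low_high_not_crs (h₁.1 h') (h₂.1 hE)).2
    · rcases hE with rfl | hE | hE
      · exact (h.root_not_crs (s₂ h')).1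
      · exact (h.low_high_not_crs (h₁.1 hE) (h₂.1 h')).1
      · exact (h₂.2 _ (h₂.1 hE)).1 hE _ h'
  · simp only [Finset.mem_insert, Finset.mem_union] at hn ⊢
    rcases h.trichotomy hδ (hn _ (Or.inr (Or.inl hcm))) (hn _ (Or.inr (Or.inr hcM)))
      with h' | h' | h'
    · exact Or.inr (Or.inl ((h₁.2 _ h').2 fun δ' hδ' => hn _ (Or.inr (Or.inl hδ'))))
    · exact Or.inr (Or.inr ((h₂.2 _ h').2 fun δ' hδ' => hn _ (Or.inr (Or.inr hδ'))))
    · exact Or.inl h'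

theorem cases_of_mem (h : Rooted u S κ m M c) {E : Finset (ℕ × ℕ)} (hE : E ∈ Tri u S)
    (hcm : (c, m) ∈ E) (hcM : (c, M) ∈ E) {δ : ℕ × ℕ} (hδ : δ ∈ E) :
    δ ∈ pairs (lowPart S κ c) ∨ δ ∈ pairs (highPart S κ c) ∨ δ = (m, M) := by
  rw [mem_Tri] at hE
  have := (hE.2 _ (hE.1 hδ)).1 hδ
  exact h.trichotomy (hE.1 hδ) (this _ hcm) (this _ hcM)

theorem restrict_low (h : Rooted u S κ m M c) {E : Finset (ℕ × ℕ)} (hE : E ∈ Tri u S)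
    (hcm : (c, m) ∈ E) (hcM : (c, M) ∈ E) :
    E ∩ pairs (lowPart S κ c) ∈ Tri u (lowPart S κ c) := by
  have hE' := mem_Tri.1 hE
  refine mem_Tri.2 ⟨Finset.inter_subset_right, fun δ hδ => ?_⟩
  simp only [Finset.mem_inter, hδ, and_true]
  rw [hE'.2 _ (pairs_mono lowPart_subset hδ)]
  refine ⟨fun H δ' hδ' => H _ hδ'.1, fun H δ' hδ' => ?_⟩
  rcases h.cases_of_mem hE hcm hcM hδ' with h' | h' | rfl
  · exact H _ ⟨hδ', h'⟩
  · exact (h.low_high_not_crs hδ h').1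
  · exact (h.root_not_crs (pairs_mono lowPart_subset hδ)).2

theorem restrict_high (h : Rooted u S κ m M c) {E : Finset (ℕ × ℕ)} (hE : E ∈ Tri u S)
    (hcm : (c, m) ∈ E) (hcM : (c, M) ∈ E) :
    E ∩ pairs (highPart S κ c) ∈ Tri u (highPart S κ c) := by
  have hE' := mem_Tri.1 hE
  refine mem_Tri.2 ⟨Finset.inter_subset_right, fun δ hδ => ?_⟩
  simp only [Finset.mem_inter, hδ, and_true]
  rw [hE'.2 _ (pairs_mono highPart_subset hδ)]
  refine ⟨fun H δ' hδ' => H _ hδ'.1, fun H δ' hδ' => ?_⟩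
  rcases h.cases_of_mem hE hcm hcM hδ' with h' | h' | rfl
  · exact (h.low_high_not_crs h' hδ).2
  · exact H _ ⟨hδ', h'⟩
  · exact (h.root_not_crs (pairs_mono highPart_subset hδ)).2

theorem root_notMem (h : Rooted u S κ m M c) :
    (m, M) ∉ pairs (lowPart S κ c) ∧ (m, M) ∉ pairs (highPart S κ c) := by
  rw [mem_pairs, mem_pairs]
  exact ⟨fun h' => h.M_notMem_low h'.2.1, fun h' => h.m_notMem_high h'.1⟩

theorem disjoint_pairs (h : Rooted u S κ m M c) {δ : ℕ × ℕ} (hδ : δ ∈ pairs (lowPart S κ c)) :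
    δ ∉ pairs (highPart S κ c) := fun hδ' => by
  rw [mem_pairs] at *
  have h1 := h.eq_c hδ.1 hδ'.1
  have h2 := h.eq_c hδ.2.1 hδ'.2.1
  omega

theorem glue_inter_low (h : Rooted u S κ m M c) {E₁ E₂ : Finset (ℕ × ℕ)}
    (h₁ : E₁ ⊆ pairs (lowPart S κ c)) (h₂ : E₂ ⊆ pairs (highPart S κ c)) :
    insert (m, M) (E₁ ∪ E₂) ∩ pairs (lowPart S κ c) = E₁ := by
  ext δ
  simp only [Finset.mem_inter, Finset.mem_insert, Finset.mem_union]
  constructor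
  · rintro ⟨rfl | h' | h', h''⟩
    · exact absurd h'' h.root_notMem.1
    · exact h'
    · exact absurd (h₂ h') (h.disjoint_pairs h'')
  · exact fun h' => ⟨Or.inr (Or.inl h'), h₁ h'⟩

theorem glue_inter_high (h : Rooted u S κ m M c) {E₁ E₂ : Finset (ℕ × ℕ)}
    (h₁ : E₁ ⊆ pairs (lowPart S κ c)) (h₂ : E₂ ⊆ pairs (highPart S κ c)) :
    insert (m, M) (E₁ ∪ E₂) ∩ pairs (highPart S κ c) = E₂ := by
  ext δ
  simp only [Finset.mem_inter, Finset.mem_insert, Finset.mem_union]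
  constructor
  · rintro ⟨rfl | h' | h', h''⟩
    · exact absurd h'' h.root_notMem.2
    · exact absurd h'' (h.disjoint_pairs (h₁ h'))
    · exact h'
  · exact fun h' => ⟨Or.inr (Or.inr h'), h₂ h'⟩

theorem root_mem_of_mem_Tri (h : Rooted u S κ m M c) {E : Finset (ℕ × ℕ)} (hE : E ∈ Tri u S) :
    (m, M) ∈ E := by
  rw [mem_Tri] at hE
  exact (hE.2 _ h.root_mem).2 fun δ hδ => (h.root_not_crs (hE.1 hδ)).1

theorem glue_restrict (h : Rooted u S κ m M c) {E : Finset (ℕ × ℕ)} (hE : E ∈ Tri u S)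
    (hcm : (c, m) ∈ E) (hcM : (c, M) ∈ E) :
    insert (m, M) (E ∩ pairs (lowPart S κ c) ∪ E ∩ pairs (highPart S κ c)) = E := by
  ext δ
  simp only [Finset.mem_inter, Finset.mem_insert, Finset.mem_union]
  constructor
  · rintro (rfl | h' | h')
    · exact h.root_mem_of_mem_Tri hE
    · exact h'.1
    · exact h'.1
  · intro h'
    have := h.cases_of_mem hE hcm hcM h'
    tauto

end Rooted

theorem rootKey_self {u : ℕ → Prop} {m M : ℕ} (hm : m < M) : rootKey u m M m = -m := by
  simp [rootKey, hm.ne]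

theorem rootKey_last {u : ℕ → Prop} {m M : ℕ} : rootKey u m M M = M := by simp [rootKey]

theorem rooted_rootKey {u : ℕ → Prop} {S : Finset ℕ} {m M c : ℕ} (hm : m ∈ S) (hM : M ∈ S)
    (hmM : m < M) (hS : ∀ v ∈ S, v = M ∨ v ≤ m) (hc : c ∈ S) (hcm : c < m) :
    Rooted u S (rootKey u m M) m M c where
  key := isKey_rootKey hmM hS
  hm := hm
  hM := hM
  hc := hc
  cm := hcm
  mM := hmM
  first v hv h := by
    rw [rootKey_self hmM]
    have := hS v hv
    unfold rootKey
    split_ifs <;> omega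
  last v hv h := by
    rw [rootKey_last]
    have := hS v hv
    unfold rootKey
    split_ifs <;> omega

theorem low_side {u : ℕ → Prop} {m M c v : ℕ} (hmM : m < M) (hcm : c < m) (hv : v < m)
    (h : rootKey u m M v < rootKey u m M c) :
    (Below u c m v ↔ ¬ u m) ∧ (Above u c m v ↔ u m) := by
  unfold rootKey at h
  unfold Below Above
  have hvc : v = c → (u v ↔ u c) := by rintro rfl; rfl
  by_cases hum : u m <;> by_cases huc : u c <;> by_cases huv : u v <;>
    simp only [hum, huc, huv, (hcm.trans hmM).ne, (hv.trans hmM).ne, if_true, if_false, iff_self,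
      iff_true, iff_false, not_true, not_false_eq_true, and_true, and_false, or_false, false_or,
      true_iff, false_iff, imp_false, implies_true] at h hvc ⊢ <;> omega

theorem high_side {u : ℕ → Prop} {m M c v : ℕ} (hmM : m < M) (hcm : c < m) (hv : v < m)
    (h : rootKey u m M c < rootKey u m M v) :
    (Below u c M v ↔ u m) ∧ (Above u c M v ↔ ¬ u m) := by
  unfold rootKey at h
  unfold Below Above
  have hvc : v = c → (u v ↔ u c) := by rintro rfl; rfl
  by_cases hum : u m <;> by_cases huc : u c <;> by_cases huv : u v <;>
    simp only [hum, huc, huv, (hcm.trans hmM).ne, (hv.trans hmM).ne, if_true, if_false, iff_self,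
      iff_true, iff_false, not_true, not_false_eq_true, and_true, and_false, or_false, false_or,
      true_iff, false_iff, imp_false, implies_true] at h hvc ⊢ <;> omega

theorem adj_insert {E₁ E₂ : Finset (ℕ × ℕ)} {m M v a : ℕ} :
    Adj (insert (m, M) (E₁ ∪ E₂)) v a ↔
      Adj E₁ v a ∨ Adj E₂ v a ∨ (v = m ∧ a = M) ∨ (v = M ∧ a = m) := by
  simp only [Adj, Finset.mem_insert, Finset.mem_union, Prod.mk.injEq]
  tauto

theorem not_adj_self {u : ℕ → Prop} {S : Finset ℕ} {E : Finset (ℕ × ℕ)} (hE : E ∈ Tri u S) {a : ℕ} :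
    ¬ Adj E a a := by
  rintro (h | h) <;> exact (mem_pairs.1 ((mem_Tri.1 hE).1 h)).2.2.false

theorem not_below_left {u : ℕ → Prop} {a b : ℕ} (hab : a < b) : ¬ Below u a b a := by
  unfold Below; omega

theorem not_above_left {u : ℕ → Prop} {a b : ℕ} (hab : a < b) : ¬ Above u a b a := by
  unfold Above; omega

theorem not_below_right {u : ℕ → Prop} {a b : ℕ} (hab : a < b) : ¬ Below u a b b := by
  unfold Below; omega

theorem not_above_right {u : ℕ → Prop} {a b : ℕ} (hab : a < b) : ¬ Above u a b b := by
  unfold Above; omega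

namespace Rooted

variable {u : ℕ → Prop} {S : Finset ℕ} {κ : ℕ → ℤ} {m M c : ℕ} {E₁ E₂ : Finset (ℕ × ℕ)}

theorem low_adj (h : Rooted u S κ m M c)
    (h₂ : E₂ ∈ Tri u (highPart S κ c)) {v a : ℕ} (ha : a ∈ lowPart S κ c) :
    Adj (insert (m, M) (E₁ ∪ E₂)) v a ↔
      Adj E₁ v a ∨ (a = c ∧ Adj E₂ v a) ∨ (a = m ∧ v = M) := by
  rw [adj_insert]
  constructor
  · rintro (h' | h' | ⟨rfl, rfl⟩ | ⟨rfl, rfl⟩)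
    · exact Or.inl h'
    · exact Or.inr (Or.inl ⟨h.eq_c ha (h'.symm.mem_left h₂), h'⟩)
    · exact absurd ha h.M_notMem_low
    · simp
  · tauto

theorem high_adj (h : Rooted u S κ m M c) (h₁ : E₁ ∈ Tri u (lowPart S κ c)) {v a : ℕ}
    (ha : a ∈ highPart S κ c) :
    Adj (insert (m, M) (E₁ ∪ E₂)) v a ↔
      Adj E₂ v a ∨ (a = c ∧ Adj E₁ v a) ∨ (a = M ∧ v = m) := by
  rw [adj_insert]
  constructor
  · rintro (h' | h' | ⟨rfl, rfl⟩ | ⟨rfl, rfl⟩)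
    · exact Or.inr (Or.inl ⟨h.eq_c (h'.symm.mem_left h₁) ha, h'⟩)
    · exact Or.inl h'
    · simp
    · exact absurd ha h.m_notMem_high
  · tauto

theorem low_triangle (h : Rooted u S κ m M c) (h₁ : E₁ ∈ Tri u (lowPart S κ c))
    (h₂ : E₂ ∈ Tri u (highPart S κ c)) {v a b : ℕ} (hab : (a, b) ∈ E₁) (hne : (a, b) ≠ (c, m)) :
    (Adj (insert (m, M) (E₁ ∪ E₂)) v a ∧ Adj (insert (m, M) (E₁ ∪ E₂)) v b) ↔
      (Adj E₁ v a ∧ Adj E₁ v b) := by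
  obtain ⟨ha, hb, hlt⟩ : a ∈ _ ∧ b ∈ _ ∧ a < b := mem_pairs.1 ((mem_Tri.1 h₁).1 hab)
  rw [h.low_adj h₂ ha, h.low_adj h₂ hb]
  refine ⟨?_, fun h' => ⟨Or.inl h'.1, Or.inl h'.2⟩⟩
  have hcm := h.cm
  rintro ⟨h1 | ⟨rfl, h1⟩ | ⟨rfl, rfl⟩, h2 | ⟨rfl, h2⟩ | ⟨e, e'⟩⟩
  · exact ⟨h1, h2⟩
  · have := h.eq_c (h1.mem_left h₁) (h2.mem_left h₂)
    subst this
    exact absurd h2 (not_adj_self h₂)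
  · subst e'
    exact absurd (h1.mem_left h₁) h.M_notMem_low
  · have := h.eq_c (h2.mem_left h₁) (h1.mem_left h₂)
    subst this
    exact absurd h1 (not_adj_self h₂)
  · omega
  · subst e
    exact absurd rfl hne
  · exact absurd (h2.mem_left h₁) h.M_notMem_low
  · omega
  · omega

theorem high_triangle (h : Rooted u S κ m M c) (h₁ : E₁ ∈ Tri u (lowPart S κ c))
    (h₂ : E₂ ∈ Tri u (highPart S κ c)) {v a b : ℕ} (hab : (a, b) ∈ E₂) (hne : (a, b) ≠ (c, M)) :
    (Adj (insert (m, M) (E₁ ∪ E₂)) v a ∧ Adj (insert (m, M) (E₁ ∪ E₂)) v b) ↔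
      (Adj E₂ v a ∧ Adj E₂ v b) := by
  obtain ⟨ha, hb, hlt⟩ : a ∈ _ ∧ b ∈ _ ∧ a < b := mem_pairs.1 ((mem_Tri.1 h₂).1 hab)
  rw [h.high_adj h₁ ha, h.high_adj h₁ hb]
  refine ⟨?_, fun h' => ⟨Or.inl h'.1, Or.inl h'.2⟩⟩
  have hcm := h.cm
  have hmM := h.mM
  rintro ⟨h1 | ⟨rfl, h1⟩ | ⟨rfl, rfl⟩, h2 | ⟨rfl, h2⟩ | ⟨e, e'⟩⟩
  · exact ⟨h1, h2⟩
  · have := h.eq_c (h2.mem_left h₁) (h1.mem_left h₂)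
    subst this
    exact absurd h2 (not_adj_self h₁)
  · subst e'
    exact absurd (h1.mem_left h₂) h.m_notMem_high
  · have := h.eq_c (h1.mem_left h₁) (h2.mem_left h₂)
    subst this
    exact absurd h1 (not_adj_self h₁)
  · omega
  · subst e
    exact absurd rfl hne
  · exact absurd (h2.mem_left h₂) h.m_notMem_high
  · omega
  · omega

theorem ordered_low (h : Rooted u S κ m M c) (h₁ : E₁ ∈ Tri u (lowPart S κ c))
    (h₂ : E₂ ∈ Tri u (highPart S κ c)) {δ : ℕ × ℕ} (hδ : δ ∈ E₁) (hne : δ ≠ (c, m)) :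
    Ordered u (insert (m, M) (E₁ ∪ E₂)) δ ↔ Ordered u E₁ δ := by
  obtain ⟨a, b⟩ := δ
  unfold Ordered
  refine exists_congr fun s => exists_congr fun t => ?_
  have := h.low_triangle h₁ h₂ (v := s) hδ hne
  have := h.low_triangle h₁ h₂ (v := t) hδ hne
  simp only
  tauto

theorem ordered_high (h : Rooted u S κ m M c) (h₁ : E₁ ∈ Tri u (lowPart S κ c))
    (h₂ : E₂ ∈ Tri u (highPart S κ c)) {δ : ℕ × ℕ} (hδ : δ ∈ E₂) (hne : δ ≠ (c, M)) :
    Ordered u (insert (m, M) (E₁ ∪ E₂)) δ ↔ Ordered u E₂ δ := by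
  obtain ⟨a, b⟩ := δ
  unfold Ordered
  refine exists_congr fun s => exists_congr fun t => ?_
  have := h.high_triangle h₁ h₂ (v := s) hδ hne
  have := h.high_triangle h₁ h₂ (v := t) hδ hne
  simp only
  tauto

end Rooted

section Root

variable {u : ℕ → Prop} {S : Finset ℕ} {m M c : ℕ} {E₁ E₂ : Finset (ℕ × ℕ)}

theorem lt_of_mem_low (h : Rooted u S (rootKey u m M) m M c) (hS : ∀ v ∈ S, v = M ∨ v ≤ m)
    {v : ℕ} (hv : v ∈ lowPart S (rootKey u m M) c) (hm : v ≠ m) : v < m := by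
  have hM : v ≠ M := by rintro rfl; exact h.M_notMem_low hv
  have := hS v (mem_lowPart.1 hv).1
  omega

theorem lt_of_mem_high (h : Rooted u S (rootKey u m M) m M c) (hS : ∀ v ∈ S, v = M ∨ v ≤ m)
    {v : ℕ} (hv : v ∈ highPart S (rootKey u m M) c) (hM : v ≠ M) : v < m := by
  have hm : v ≠ m := by rintro rfl; exact h.m_notMem_high hv
  have := hS v (mem_highPart.1 hv).1
  omega

theorem side_of_mem_low (h : Rooted u S (rootKey u m M) m M c) (hS : ∀ v ∈ S, v = M ∨ v ≤ m)
    {v : ℕ} (hv : v ∈ lowPart S (rootKey u m M) c) (hm : v ≠ m) (hc : v ≠ c) :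
    (Below u c m v ↔ ¬ u m) ∧ (Above u c m v ↔ u m) := by
  refine low_side h.mM h.cm (lt_of_mem_low h hS hv hm) ?_
  rw [mem_lowPart] at hv
  exact lt_of_le_of_ne hv.2 fun e => hc (h.key.inj _ hv.1 _ h.hc e)

theorem side_of_mem_high (h : Rooted u S (rootKey u m M) m M c) (hS : ∀ v ∈ S, v = M ∨ v ≤ m)
    {v : ℕ} (hv : v ∈ highPart S (rootKey u m M) c) (hM : v ≠ M) (hc : v ≠ c) :
    (Below u c M v ↔ u m) ∧ (Above u c M v ↔ ¬ u m) := by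
  refine high_side h.mM h.cm (lt_of_mem_high h hS hv hM) ?_
  rw [mem_highPart] at hv
  exact lt_of_le_of_ne hv.2 fun e => hc (h.key.inj _ hv.1 _ h.hc e.symm)

theorem not_ordered_root (h : Rooted u S (rootKey u m M) m M c) (hS : ∀ v ∈ S, v = M ∨ v ≤ m)
    {E : Finset (ℕ × ℕ)} (hE : E ∈ Tri u S) : ¬ Ordered u E (m, M) := by
  rintro ⟨s, t, hs, ht, h1, h2, h3, h4, -⟩
  have hs' := hS s (h1.mem_left hE)
  have ht' := hS t (h3.mem_left hE)
  have hmM := h.mM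
  simp only [Below, Above] at hs ht
  by_cases hum : u m <;> simp only [hum, and_true, and_false, not_true, false_or,
    not_false_eq_true] at hs ht <;> omega

theorem not_ordered_low (h : Rooted u S (rootKey u m M) m M c) (hS : ∀ v ∈ S, v = M ∨ v ≤ m)
    (h₁ : E₁ ∈ Tri u (lowPart S (rootKey u m M) c)) : ¬ Ordered u E₁ (c, m) := by
  rintro ⟨s, t, hs, ht, h1, h2, h3, h4, -⟩
  have hs' := side_of_mem_low h hS (h1.mem_left h₁)
    (by rintro rfl; exact not_below_right h.cm hs) (by rintro rfl; exact not_below_left h.cm hs)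
  have ht' := side_of_mem_low h hS (h3.mem_left h₁)
    (by rintro rfl; exact not_above_right h.cm ht) (by rintro rfl; exact not_above_left h.cm ht)
  exact hs'.1.1 hs (ht'.2.1 ht)

theorem not_ordered_high (h : Rooted u S (rootKey u m M) m M c) (hS : ∀ v ∈ S, v = M ∨ v ≤ m)
    (h₂ : E₂ ∈ Tri u (highPart S (rootKey u m M) c)) : ¬ Ordered u E₂ (c, M) := by
  have hcM := h.cm.trans h.mM
  rintro ⟨s, t, hs, ht, h1, h2, h3, h4, -⟩
  have hs' := side_of_mem_high h hS (h1.mem_left h₂)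
    (by rintro rfl; exact not_below_right hcM hs) (by rintro rfl; exact not_below_left hcM hs)
  have ht' := side_of_mem_high h hS (h3.mem_left h₂)
    (by rintro rfl; exact not_above_right hcM ht) (by rintro rfl; exact not_above_left hcM ht)
  exact ht'.2.1 ht (hs'.1.1 hs)

theorem ordered_cm (h : Rooted u S (rootKey u m M) m M c) (hS : ∀ v ∈ S, v = M ∨ v ≤ m)
    (h₁ : E₁ ∈ Tri u (lowPart S (rootKey u m M) c))
    (h₂ : E₂ ∈ Tri u (highPart S (rootKey u m M) c)) :
    Ordered u (insert (m, M) (E₁ ∪ E₂)) (c, m) ↔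
      ¬ u m ∧ ∃ x ∈ lowPart S (rootKey u m M) c, x ≠ m ∧ x ≠ c := by
  have hE := h.glue h₁ h₂
  have hcm := h.cm
  have hmM := h.mM
  have third : ∀ v, Adj (insert (m, M) (E₁ ∪ E₂)) v m →
      v = M ∨ v ∈ lowPart S (rootKey u m M) c := by
    intro v hv
    rcases (h.low_adj h₂ h.m_mem_low).1 hv with h' | ⟨h', -⟩ | ⟨-, h'⟩
    · exact Or.inr (h'.mem_left h₁)
    · exact absurd h' hcm.ne'
    · exact Or.inl h'
  constructor
  · rintro ⟨s, t, hs, ht, h1, h2, h3, h4, hlt⟩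
    have sm : s ≠ m := by rintro rfl; exact not_below_right hcm hs
    have sc : s ≠ c := by rintro rfl; exact not_below_left hcm hs
    by_cases hum : u m
    · exfalso
      rcases third s h2 with rfl | h'
      · simp only [clamp] at hlt
        omega
      · exact (side_of_mem_low h hS h' sm sc).1.1 hs hum
    · refine ⟨hum, ?_⟩
      rcases third s h2 with rfl | h'
      · exfalso
        simp only [Below, hum, and_false, or_false] at hs
        omega
      · exact ⟨s, h', sm, sc⟩
  · rintro ⟨hum, x, hx, hxm, hxc⟩
    rw [mem_lowPart] at hx
    have hcmE : (c, m) ∈ insert (m, M) (E₁ ∪ E₂) := Finset.mem_insert_of_mem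
      (Finset.mem_union_left _ (((mem_Tri.1 h₁).2 _ h.cm_mem_low).2 fun δ hδ =>
        h.cm_not_crs ((mem_Tri.1 h₁).1 hδ)))
    have hcME : (c, M) ∈ insert (m, M) (E₁ ∪ E₂) := Finset.mem_insert_of_mem
      (Finset.mem_union_right _ (((mem_Tri.1 h₂).2 _ h.cM_mem_high).2 fun δ hδ =>
        h.cM_not_crs ((mem_Tri.1 h₂).1 hδ)))
    obtain ⟨s, hs1, hs2, hs3, hs4⟩ := exists_triangle h.key hE (a := m) (b := c) (Or.inr hcmE) hx.1
      (h.first x hx.1 hxm) (lt_of_le_of_ne hx.2 fun e => hxc (h.key.inj _ hx.1 _ h.hc e))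
    have hsm : s ≠ m := by rintro rfl; omega
    have hsc : s ≠ c := by rintro rfl; omega
    have hsl := mem_lowPart.2 ⟨hs4.mem_left hE, hs2.le⟩
    have hlt := lt_of_mem_low h hS hsl hsm
    refine ⟨s, M, (side_of_mem_low h hS hsl hsm hsc).1.2 hum, Or.inr (Or.inr ⟨hmM, hum⟩), hs4,
      hs3.symm, Or.inr hcME, Or.inr (h.root_mem_of_mem_Tri hE), ?_⟩
    simp only [clamp]
    omega

theorem ordered_cM (h : Rooted u S (rootKey u m M) m M c) (hS : ∀ v ∈ S, v = M ∨ v ≤ m)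
    (h₁ : E₁ ∈ Tri u (lowPart S (rootKey u m M) c))
    (h₂ : E₂ ∈ Tri u (highPart S (rootKey u m M) c)) :
    Ordered u (insert (m, M) (E₁ ∪ E₂)) (c, M) ↔
      u m ∧ ∃ x ∈ highPart S (rootKey u m M) c, x ≠ M ∧ x ≠ c := by
  have hE := h.glue h₁ h₂
  have hcm := h.cm
  have hmM := h.mM
  have hcM := hcm.trans hmM
  have third : ∀ v, Adj (insert (m, M) (E₁ ∪ E₂)) v M →
      v = m ∨ v ∈ highPart S (rootKey u m M) c := by
    intro v hv
    rcases (h.high_adj h₁ h.M_mem_high).1 hv with h' | ⟨h', -⟩ | ⟨-, h'⟩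
    · exact Or.inr (h'.mem_left h₂)
    · exact absurd h' hcM.ne'
    · exact Or.inl h'
  constructor
  · rintro ⟨s, t, hs, ht, h1, h2, h3, h4, hlt⟩
    have sM : s ≠ M := by rintro rfl; exact not_below_right hcM hs
    have sc : s ≠ c := by rintro rfl; exact not_below_left hcM hs
    have tM : t ≠ M := by rintro rfl; exact not_above_right hcM ht
    by_cases hum : u m
    · refine ⟨hum, ?_⟩
      rcases third s h2 with rfl | h'
      · exfalso
        simp only [Below, hum, not_true, and_false, false_or] at hs
        omega
      · exact ⟨s, h', sM, sc⟩
    · exfalso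
      rcases third s h2 with rfl | h'
      · have : t ≤ s := by
          rcases third t h4 with rfl | h''
          · exact le_rfl
          · exact (lt_of_mem_high h hS h'' tM).le
        simp only [clamp] at hlt
        omega
      · exact hum ((side_of_mem_high h hS h' sM sc).1.1 hs)
  · rintro ⟨hum, x, hx, hxM, hxc⟩
    rw [mem_highPart] at hx
    have hcmE : (c, m) ∈ insert (m, M) (E₁ ∪ E₂) := Finset.mem_insert_of_mem
      (Finset.mem_union_left _ (((mem_Tri.1 h₁).2 _ h.cm_mem_low).2 fun δ hδ =>
        h.cm_not_crs ((mem_Tri.1 h₁).1 hδ)))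
    have hcME : (c, M) ∈ insert (m, M) (E₁ ∪ E₂) := Finset.mem_insert_of_mem
      (Finset.mem_union_right _ (((mem_Tri.1 h₂).2 _ h.cM_mem_high).2 fun δ hδ =>
        h.cM_not_crs ((mem_Tri.1 h₂).1 hδ)))
    obtain ⟨s, hs1, hs2, hs3, hs4⟩ := exists_triangle h.key hE (a := c) (b := M) (Or.inl hcME) hx.1
      (lt_of_le_of_ne hx.2 fun e => hxc (h.key.inj _ hx.1 _ h.hc e.symm)) (h.last x hx.1 hxM)
    have hsM : s ≠ M := by rintro rfl; omega
    have hsc : s ≠ c := by rintro rfl; omega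
    have hsl := mem_highPart.2 ⟨hs4.mem_left hE, hs1.le⟩
    have hlt := lt_of_mem_high h hS hsl hsM
    refine ⟨s, m, (side_of_mem_high h hS hsl hsM hsc).1.2 hum, Or.inr (Or.inl ⟨hcm, hmM, hum⟩),
      hs3.symm, hs4, Or.inr hcmE, Or.inl (h.root_mem_of_mem_Tri hE), ?_⟩
    simp only [clamp]
    omega

/-- The contribution of the two edges at the apex `c` of the root triangle. -/
def apexWeight (u : ℕ → Prop) (S : Finset ℕ) (m M c : ℕ) : ℕ :=
  if u m then (if ∃ x ∈ highPart S (rootKey u m M) c, x ≠ M ∧ x ≠ c then 1 else 0)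
  else (if ∃ x ∈ lowPart S (rootKey u m M) c, x ≠ m ∧ x ≠ c then 1 else 0)

theorem ord_glue (h : Rooted u S (rootKey u m M) m M c) (hS : ∀ v ∈ S, v = M ∨ v ≤ m)
    (h₁ : E₁ ∈ Tri u (lowPart S (rootKey u m M) c))
    (h₂ : E₂ ∈ Tri u (highPart S (rootKey u m M) c)) :
    ord u (insert (m, M) (E₁ ∪ E₂)) = apexWeight u S m M c + ord u E₁ + ord u E₂ := by
  have hE := h.glue h₁ h₂
  have s₁ := (mem_Tri.1 h₁).1
  have s₂ := (mem_Tri.1 h₂).1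
  have hcm : (c, m) ∈ E₁ := ((mem_Tri.1 h₁).2 _ h.cm_mem_low).2 fun δ hδ => h.cm_not_crs (s₁ hδ)
  have hcM : (c, M) ∈ E₂ := ((mem_Tri.1 h₂).2 _ h.cM_mem_high).2 fun δ hδ => h.cM_not_crs (s₂ hδ)
  have hroot : (m, M) ∉ E₁ ∪ E₂ := by
    rw [Finset.mem_union]
    rintro (h' | h')
    · exact h.root_notMem.1 (s₁ h')
    · exact h.root_notMem.2 (s₂ h')
  have hdis : Disjoint E₁ E₂ :=
    Finset.disjoint_left.2 fun δ hδ hδ' => h.disjoint_pairs (s₁ hδ) (s₂ hδ')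
  have e₁ : ∑ δ ∈ E₁.erase (c, m), (if Ordered u (insert (m, M) (E₁ ∪ E₂)) δ then 1 else 0) =
      ∑ δ ∈ E₁.erase (c, m), (if Ordered u E₁ δ then 1 else 0) :=
    Finset.sum_congr rfl fun δ hδ => by
      rw [Finset.mem_erase] at hδ
      simp only [h.ordered_low h₁ h₂ hδ.2 hδ.1]
  have e₂ : ∑ δ ∈ E₂.erase (c, M), (if Ordered u (insert (m, M) (E₁ ∪ E₂)) δ then 1 else 0) =
      ∑ δ ∈ E₂.erase (c, M), (if Ordered u E₂ δ then 1 else 0) :=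
    Finset.sum_congr rfl fun δ hδ => by
      rw [Finset.mem_erase] at hδ
      simp only [h.ordered_high h₁ h₂ hδ.2 hδ.1]
  unfold ord
  rw [Finset.sum_insert hroot, Finset.sum_union hdis, ← Finset.sum_erase_add _ _ hcm,
    ← Finset.sum_erase_add _ _ hcM, e₁, e₂, ← Finset.sum_erase_add _ _ hcm,
    ← Finset.sum_erase_add _ _ hcM, if_neg (not_ordered_root h hS hE),
    if_neg (not_ordered_low h hS h₁), if_neg (not_ordered_high h hS h₂)]
  simp only [ordered_cm h hS h₁ h₂, ordered_cM h hS h₁ h₂, apexWeight]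
  by_cases hum : u m
  · simp only [hum, not_true, false_and, true_and, if_true, if_false]
    ring
  · simp only [hum, not_false_eq_true, false_and, true_and, if_false]
    ring

end Root

open Polynomial in
/-- The generating polynomials of the Narayana numbers. -/
def narPoly : ℕ → ℚ[X]
  | 0 => 1
  | k + 1 => ∑ i : Fin (k + 1), (if (i : ℕ) = 0 then 1 else X) * narPoly i * narPoly (k - i)

open Polynomial in
theorem narPoly_succ (k : ℕ) : narPoly (k + 1) =
    ∑ i ∈ Finset.range (k + 1), (if i = 0 then 1 else X) * narPoly i * narPoly (k - i) := by
  rw [narPoly, Finset.sum_range]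

/-- The number of elements of `A` before `c` in the order given by `κ`. -/
def rank (A : Finset ℕ) (κ : ℕ → ℤ) (c : ℕ) : ℕ := (A.filter fun v => κ v < κ c).card

theorem sum_rank {β : Type*} [AddCommMonoid β] {A : Finset ℕ} {κ : ℕ → ℤ}
    (hκ : ∀ a ∈ A, ∀ b ∈ A, κ a = κ b → a = b) (f : ℕ → β) :
    ∑ c ∈ A, f (rank A κ c) = ∑ i ∈ Finset.range A.card, f i := by
  have lt : ∀ a ∈ A, ∀ b, κ a < κ b → rank A κ a < rank A κ b := fun a ha b hab =>
    Finset.card_lt_card ⟨fun v hv => by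
      rw [Finset.mem_filter] at *; exact ⟨hv.1, hv.2.trans hab⟩, fun hsub => by
      simpa using hsub (Finset.mem_filter.2 ⟨ha, hab⟩)⟩
  have inj : Set.InjOn (rank A κ) A := by
    intro a ha b hb e
    rcases lt_trichotomy (κ a) (κ b) with h | h | h
    · exact absurd e (lt a ha b h).ne
    · exact hκ a ha b hb h
    · exact absurd e (lt b hb a h).ne'
  have img : A.image (rank A κ) = Finset.range A.card := by
    refine Finset.eq_of_subset_of_card_le ?_ ?_
    · intro i hi
      obtain ⟨c, hc, rfl⟩ := Finset.mem_image.1 hi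
      exact Finset.mem_range.2 (Finset.card_lt_card
        ⟨Finset.filter_subset _ _, fun hsub => by simpa using hsub hc⟩)
    · rw [Finset.card_image_of_injOn inj, Finset.card_range]
  rw [← img, Finset.sum_image inj]

theorem rank_add_rank {A : Finset ℕ} {κ : ℕ → ℤ} (hκ : ∀ a ∈ A, ∀ b ∈ A, κ a = κ b → a = b)
    {c : ℕ} (hc : c ∈ A) : rank A κ c + rank A (fun v => -κ v) c + 1 = A.card := by
  unfold rank
  have e : (A.filter fun v => -κ v < -κ c) = (A.filter fun v => ¬ κ v < κ c).erase c := by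
    ext v
    simp only [Finset.mem_filter, Finset.mem_erase]
    constructor
    · rintro ⟨h1, h2⟩
      exact ⟨by rintro rfl; omega, h1, by omega⟩
    · rintro ⟨h1, h2, h3⟩
      exact ⟨h2, by have : κ v ≠ κ c := fun e => h1 (hκ v h2 c hc e); omega⟩
  have hc' : c ∈ A.filter fun v => ¬ κ v < κ c := by simp [hc]
  rw [e, add_assoc, Finset.card_erase_add_one hc', Finset.card_filter_add_card_filter_not]

section Recursion

variable {u : ℕ → Prop} {S : Finset ℕ} {m M : ℕ}

theorem card_lowPart {c : ℕ} (h : Rooted u S (rootKey u m M) m M c) :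
    (lowPart S (rootKey u m M) c).card = rank ((S.erase m).erase M) (rootKey u m M) c + 2 := by
  have hcm := h.cm
  have hmM := h.mM
  have e : lowPart S (rootKey u m M) c = insert m (insert c
      (((S.erase m).erase M).filter fun v => rootKey u m M v < rootKey u m M c)) := by
    ext v
    simp only [mem_lowPart, Finset.mem_insert, Finset.mem_filter, Finset.mem_erase]
    constructor
    · rintro ⟨h1, h2⟩
      by_cases h3 : v = m
      · exact Or.inl h3
      by_cases h4 : v = c
      · exact Or.inr (Or.inl h4)
      refine Or.inr (Or.inr ⟨⟨?_, h3, h1⟩, ?_⟩)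
      · rintro rfl
        exact h.M_notMem_low (mem_lowPart.2 ⟨h1, h2⟩)
      · exact lt_of_le_of_ne h2 fun e => h4 (h.key.inj _ h1 _ h.hc e)
    · rintro (rfl | rfl | h1)
      · exact ⟨h.hm, h.key_m_c.le⟩
      · exact ⟨h.hc, le_rfl⟩
      · exact ⟨h1.1.2.2, h1.2.le⟩
  rw [e, Finset.card_insert_of_notMem (by simp [hcm.ne']),
    Finset.card_insert_of_notMem (by simp), rank]

theorem card_highPart {c : ℕ} (h : Rooted u S (rootKey u m M) m M c) :
    (highPart S (rootKey u m M) c).card =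
      rank ((S.erase m).erase M) (fun v => -rootKey u m M v) c + 2 := by
  have hcm := h.cm
  have hmM := h.mM
  have e : highPart S (rootKey u m M) c = insert M (insert c
      (((S.erase m).erase M).filter fun v => -rootKey u m M v < -rootKey u m M c)) := by
    ext v
    simp only [mem_highPart, Finset.mem_insert, Finset.mem_filter, Finset.mem_erase]
    constructor
    · rintro ⟨h1, h2⟩
      by_cases h3 : v = M
      · exact Or.inl h3
      by_cases h4 : v = c
      · exact Or.inr (Or.inl h4)
      refine Or.inr (Or.inr ⟨⟨h3, ?_, h1⟩, neg_lt_neg ?_⟩)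
      · rintro rfl
        exact h.m_notMem_high (mem_highPart.2 ⟨h1, h2⟩)
      · exact lt_of_le_of_ne h2 fun e => h4 (h.key.inj _ h1 _ h.hc e.symm)
    · rintro (rfl | rfl | h1)
      · exact ⟨h.hM, h.key_c_M.le⟩
      · exact ⟨h.hc, le_rfl⟩
      · exact ⟨h1.1.2.2, by have := h1.2; omega⟩
  rw [e, Finset.card_insert_of_notMem (by simp [(hcm.trans hmM).ne']),
    Finset.card_insert_of_notMem (by simp), rank]

theorem exists_third_iff {B : Finset ℕ} {a c r : ℕ} (hac : a ≠ c) (ha : a ∈ B) (hc : c ∈ B)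
    (hB : B.card = r + 2) : (∃ x ∈ B, x ≠ a ∧ x ≠ c) ↔ r ≠ 0 := by
  have e : ((B.erase a).erase c).card = r := by
    rw [Finset.card_erase_of_mem (by simp [hac.symm, hc]), Finset.card_erase_of_mem ha]
    omega
  rw [← e, Finset.card_ne_zero]
  simp only [Finset.Nonempty, Finset.mem_erase]
  exact exists_congr fun x => by tauto

theorem apexWeight_eq {c : ℕ} (h : Rooted u S (rootKey u m M) m M c) :
    apexWeight u S m M c =
      if u m then (if rank ((S.erase m).erase M) (fun v => -rootKey u m M v) c = 0 then 0 else 1)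
      else (if rank ((S.erase m).erase M) (rootKey u m M) c = 0 then 0 else 1) := by
  unfold apexWeight
  simp only [exists_third_iff (h.cm.trans h.mM).ne' h.M_mem_high h.c_mem_high (card_highPart h),
    exists_third_iff h.cm.ne' h.m_mem_low h.c_mem_low (card_lowPart h), ne_eq, ite_not]

open Polynomial

/-- The triangulations of the polygon with vertex set `S`, counted by ordered arcs. -/
def ordPoly (u : ℕ → Prop) (S : Finset ℕ) : ℚ[X] := ∑ E ∈ Tri u S, X ^ ord u E

theorem ordPoly_eq_sum (hm : m ∈ S) (hM : M ∈ S) (hmM : m < M) (hS : ∀ v ∈ S, v = M ∨ v ≤ m)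
    (hne : ((S.erase m).erase M).Nonempty) :
    ordPoly u S = ∑ c ∈ (S.erase m).erase M, X ^ apexWeight u S m M c *
      ordPoly u (lowPart S (rootKey u m M) c) * ordPoly u (highPart S (rootKey u m M) c) := by
  have rooted : ∀ c ∈ (S.erase m).erase M, Rooted u S (rootKey u m M) m M c := by
    intro c hc
    simp only [Finset.mem_erase] at hc
    exact rooted_rootKey hm hM hmM hS hc.2.2 (by have := hS c hc.2.2; omega)
  have apex : ∀ {c E₁ E₂}, c ∈ (S.erase m).erase M →
      E₁ ∈ Tri u (lowPart S (rootKey u m M) c) → E₂ ∈ Tri u (highPart S (rootKey u m M) c) →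
      (c, m) ∈ insert (m, M) (E₁ ∪ E₂) ∧ (c, M) ∈ insert (m, M) (E₁ ∪ E₂) := by
    intro c E₁ E₂ hc h₁ h₂
    have h := rooted c hc
    exact ⟨Finset.mem_insert_of_mem (Finset.mem_union_left _
      (((mem_Tri.1 h₁).2 _ h.cm_mem_low).2 fun δ hδ => h.cm_not_crs ((mem_Tri.1 h₁).1 hδ))),
      Finset.mem_insert_of_mem (Finset.mem_union_right _
      (((mem_Tri.1 h₂).2 _ h.cM_mem_high).2 fun δ hδ => h.cM_not_crs ((mem_Tri.1 h₂).1 hδ)))⟩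
  have expand : ∀ c ∈ (S.erase m).erase M, X ^ apexWeight u S m M c *
      ordPoly u (lowPart S (rootKey u m M) c) * ordPoly u (highPart S (rootKey u m M) c) =
      ∑ p ∈ Tri u (lowPart S (rootKey u m M) c) ×ˢ Tri u (highPart S (rootKey u m M) c),
        X ^ ord u (insert (m, M) (p.1 ∪ p.2)) := by
    intro c hc
    rw [ordPoly, ordPoly, mul_assoc, Finset.sum_mul_sum, ← Finset.sum_product', Finset.mul_sum]
    refine Finset.sum_congr rfl fun p hp => ?_
    rw [Finset.mem_product] at hp
    rw [ord_glue (rooted c hc) hS hp.1 hp.2, pow_add, pow_add, mul_assoc]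
  rw [Finset.sum_congr rfl expand, Finset.sum_sigma', ordPoly]
  symm
  refine Finset.sum_bij (fun q _ => insert (m, M) (q.2.1 ∪ q.2.2)) ?_ ?_ ?_ fun _ _ => rfl
  · rintro ⟨c, E₁, E₂⟩ hq
    simp only [Finset.mem_sigma, Finset.mem_product] at hq
    exact (rooted c hq.1).glue hq.2.1 hq.2.2
  · rintro ⟨c, E₁, E₂⟩ hq ⟨d, F₁, F₂⟩ hq' e
    simp only [Finset.mem_sigma, Finset.mem_product] at hq hq' e
    have a := apex hq.1 hq.2.1 hq.2.2
    have b := apex hq'.1 hq'.2.1 hq'.2.2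
    have h := rooted c hq.1
    have h' := rooted d hq'.1
    have hE := h.glue hq.2.1 hq.2.2
    have hcd : c = d := triangle_unique h.key hE h.key_m_c h.key_c_M h'.key_m_c h'.key_c_M
      (Or.inr a.1) (Or.inl a.2) (Or.inr (e ▸ b.1)) (Or.inl (e ▸ b.2))
    subst hcd
    have e₁ := h.glue_inter_low (mem_Tri.1 hq.2.1).1 (mem_Tri.1 hq.2.2).1
    have e₂ := h.glue_inter_high (mem_Tri.1 hq.2.1).1 (mem_Tri.1 hq.2.2).1
    rw [e, h.glue_inter_low (mem_Tri.1 hq'.2.1).1 (mem_Tri.1 hq'.2.2).1] at e₁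
    rw [e, h.glue_inter_high (mem_Tri.1 hq'.2.1).1 (mem_Tri.1 hq'.2.2).1] at e₂
    rw [e₁, e₂]
  · intro E hE
    obtain ⟨x, hx⟩ := hne
    have h := rooted x hx
    obtain ⟨c, hmc, hcM, h1, h2⟩ := exists_triangle h.key hE
      (Or.inl (h.root_mem_of_mem_Tri hE)) h.hc h.key_m_c h.key_c_M
    have hcS := h2.mem_left hE
    have hc : c ∈ (S.erase m).erase M := by
      simp only [Finset.mem_erase]
      exact ⟨by rintro rfl; omega, by rintro rfl; omega, hcS⟩
    have h' := rooted c hc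
    have hcm := h'.cm
    have hcm' : (c, m) ∈ E := h1.resolve_left fun H =>
      absurd (mem_pairs.1 ((mem_Tri.1 hE).1 H)).2.2 hcm.le.not_gt
    have hcM' : (c, M) ∈ E := h2.resolve_right fun H =>
      absurd (mem_pairs.1 ((mem_Tri.1 hE).1 H)).2.2 (hcm.trans hmM).le.not_gt
    exact ⟨⟨c, E ∩ pairs (lowPart S (rootKey u m M) c), E ∩ pairs (highPart S (rootKey u m M) c)⟩,
      by simp only [Finset.mem_sigma, Finset.mem_product]
         exact ⟨hc, h'.restrict_low hE hcm' hcM', h'.restrict_high hE hcm' hcM'⟩,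
      h'.glue_restrict hE hcm' hcM'⟩

theorem ordPoly_pair (hm : m ∈ S) (hM : M ∈ S) (hmM : m < M) (hS : ∀ v ∈ S, v = M ∨ v = m) :
    ordPoly u S = 1 := by
  have hp : ∀ δ, δ ∈ pairs S ↔ δ = (m, M) := by
    rintro ⟨a, b⟩
    simp only [mem_pairs, Prod.mk.injEq]
    constructor
    · rintro ⟨ha, hb, hab⟩
      have := hS a ha
      have := hS b hb
      omega
    · rintro ⟨rfl, rfl⟩
      exact ⟨hm, hM, hmM⟩
  have hcr : ¬ Crs u (m, M) (m, M) := by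
    unfold Crs Below Above
    simp only
    omega
  have hT : Tri u S = {{(m, M)}} := by
    ext E
    rw [mem_Tri, Finset.mem_singleton]
    constructor
    · rintro ⟨h1, h2⟩
      have : (m, M) ∈ E := by
        rw [h2 _ ((hp _).2 rfl)]
        intro δ hδ
        rw [(hp _).1 (h1 hδ)]
        exact hcr
      ext δ
      rw [Finset.mem_singleton]
      exact ⟨fun h => (hp _).1 (h1 h), fun h => h ▸ this⟩
    · rintro rfl
      refine ⟨fun δ hδ => (hp _).2 (Finset.mem_singleton.1 hδ), fun δ hδ => ?_⟩
      rw [(hp _).1 hδ]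
      simp [hcr]
  have ho : ¬ Ordered u {(m, M)} (m, M) := by
    rintro ⟨s, t, -, -, h1, h2, -⟩
    simp only [Adj, Finset.mem_singleton, Prod.mk.injEq] at h1 h2
    omega
  rw [ordPoly, hT, Finset.sum_singleton, ord, Finset.sum_singleton, if_neg ho, pow_zero]

theorem ordPoly_eq_narPoly (u : ℕ → Prop) (k : ℕ) :
    ∀ S : Finset ℕ, S.card = k + 2 → ordPoly u S = narPoly k := by
  induction k using Nat.strong_induction_on with
  | _ k ih =>
  intro S hcard
  have hS0 : S.Nonempty := Finset.card_pos.1 (by omega)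
  set M := S.max' hS0
  have hM : M ∈ S := S.max'_mem _
  have hS1 : (S.erase M).Nonempty := Finset.card_pos.1 (by rw [Finset.card_erase_of_mem hM]; omega)
  set m := (S.erase M).max' hS1
  have hm' : m ∈ S.erase M := Finset.max'_mem _ _
  have hm : m ∈ S := Finset.mem_of_mem_erase hm'
  have hmM : m < M := lt_of_le_of_ne (S.le_max' _ hm) (Finset.ne_of_mem_erase hm')
  have hS : ∀ v ∈ S, v = M ∨ v ≤ m := fun v hv => by
    by_cases h : v = M
    · exact Or.inl h
    · exact Or.inr (Finset.le_max' _ _ (Finset.mem_erase.2 ⟨h, hv⟩))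
  clear_value M m
  have hA : ((S.erase m).erase M).card = k := by
    rw [Finset.card_erase_of_mem (by simp [hmM.ne', hM]), Finset.card_erase_of_mem hm]
    omega
  cases k with
  | zero =>
    rw [ordPoly_pair hm hM hmM, narPoly]
    intro v hv
    by_contra! h
    have : v ∈ (S.erase m).erase M := by simp [h, hv]
    rw [Finset.card_eq_zero.1 hA] at this
    simp at this
  | succ k =>
    have rooted : ∀ c ∈ (S.erase m).erase M, Rooted u S (rootKey u m M) m M c := by
      intro c hc
      simp only [Finset.mem_erase] at hc
      exact rooted_rootKey hm hM hmM hS hc.2.2 (by have := hS c hc.2.2; omega)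
    have inj : ∀ a ∈ (S.erase m).erase M, ∀ b ∈ (S.erase m).erase M,
        rootKey u m M a = rootKey u m M b → a = b := fun a ha b hb =>
      (rooted a ha).key.inj a (rooted a ha).hc b (rooted b hb).hc
    rw [ordPoly_eq_sum hm hM hmM hS (Finset.card_pos.1 (by omega)), narPoly_succ, ← hA]
    by_cases hum : u m
    · rw [← sum_rank (κ := fun v => -rootKey u m M v) fun a ha b hb e =>
        inj a ha b hb (neg_injective e)]
      refine Finset.sum_congr rfl fun c hc => ?_
      have h := rooted c hc
      have hr := rank_add_rank inj hc
      rw [apexWeight_eq h, ih _ (by omega) _ (card_lowPart h),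
        ih _ (by omega) _ (card_highPart h), if_pos hum, mul_right_comm, pow_ite, pow_zero,
        pow_one, show k - rank ((S.erase m).erase M) (fun v => -rootKey u m M v) c =
          rank ((S.erase m).erase M) (rootKey u m M) c by omega]
    · rw [← sum_rank inj]
      refine Finset.sum_congr rfl fun c hc => ?_
      have h := rooted c hc
      have hr := rank_add_rank inj hc
      rw [apexWeight_eq h, ih _ (by omega) _ (card_lowPart h),
        ih _ (by omega) _ (card_highPart h), if_neg hum, pow_ite, pow_zero,
        pow_one, show k - rank ((S.erase m).erase M) (rootKey u m M) c =
          rank ((S.erase m).erase M) (fun v => -rootKey u m M v) c by omega]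

end Recursion

section ClosedForm

open Polynomial

/-- The generating function of the polynomials `narPoly`. -/
def narSeries : PowerSeries ℚ[X] := PowerSeries.mk narPoly

theorem narSeries_eq : narSeries = 1 + PowerSeries.X *
    ((1 + PowerSeries.C (X : ℚ[X]) * (narSeries - 1)) * narSeries) := by
  ext1 k
  cases k with
  | zero => simp [narSeries, narPoly]
  | succ k =>
    rw [map_add, PowerSeries.coeff_succ_X_mul, PowerSeries.coeff_one, if_neg k.succ_ne_zero,
      zero_add, PowerSeries.coeff_mul, narSeries, PowerSeries.coeff_mk, narPoly_succ,
      Finset.Nat.sum_antidiagonal_eq_sum_range_succ_mk]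
    refine Finset.sum_congr rfl fun i _ => ?_
    rw [map_add, PowerSeries.coeff_C_mul, map_sub, PowerSeries.coeff_mk, PowerSeries.coeff_mk,
      PowerSeries.coeff_one]
    rcases eq_or_ne i 0 with rfl | hi
    · simp [narPoly]
    · simp [hi]

/-- The square root of the discriminant in the functional equation of `narSeries`. -/
def narRoot : PowerSeries ℚ[X] :=
  2 * PowerSeries.X * PowerSeries.C X * narSeries + PowerSeries.X * PowerSeries.C (1 - X) - 1

theorem narRoot_sq : narRoot ^ 2 = 1 - 2 * PowerSeries.C (1 + X) * PowerSeries.X +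
    PowerSeries.C (1 - X) ^ 2 * PowerSeries.X ^ 2 := by
  have h := narSeries_eq
  rw [narRoot]
  simp only [map_add, map_sub, map_one]
  linear_combination (-4 * PowerSeries.X * PowerSeries.C (X : ℚ[X])) * h

theorem narRoot_deriv :
    (1 - 2 * PowerSeries.C (1 + X) * PowerSeries.X +
      PowerSeries.C (1 - X) ^ 2 * PowerSeries.X ^ 2) *
      PowerSeries.derivative ℚ[X] narRoot =
    (-PowerSeries.C (1 + X) + PowerSeries.C (1 - X) ^ 2 * PowerSeries.X) * narRoot := by
  have h := congrArg (PowerSeries.derivative ℚ[X]) narRoot_sq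
  simp only [pow_two, map_add, map_sub, Derivation.leibniz, PowerSeries.derivative_X,
    PowerSeries.derivative_C, smul_eq_mul, Derivation.map_one_eq_zero] at h
  have h2 : PowerSeries.derivative ℚ[X] (2 : PowerSeries ℚ[X]) = 0 := by
    rw [← map_ofNat (PowerSeries.C (R := ℚ[X])) 2, PowerSeries.derivative_C]
  rw [h2] at h
  have e : (2 : PowerSeries ℚ[X]) ≠ 0 := by
    intro h
    have := congrArg PowerSeries.constantCoeff h
    rw [map_ofNat, map_zero] at this
    exact two_ne_zero this
  refine mul_left_cancel₀ e ?_
  rw [← narRoot_sq]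
  simp only [map_add, map_sub, map_one] at h ⊢
  linear_combination narRoot * h

theorem coeff_narRoot (k : ℕ) :
    PowerSeries.coeff (k + 2) narRoot = 2 * X * narPoly (k + 1) := by
  rw [show narRoot =
      PowerSeries.X * (PowerSeries.C (2 * X) * narSeries + PowerSeries.C (1 - X)) - 1 by
    rw [narRoot, map_mul, map_ofNat]; ring, map_sub, PowerSeries.coeff_succ_X_mul, map_add,
    PowerSeries.coeff_C_mul, PowerSeries.coeff_C, PowerSeries.coeff_one, if_neg k.succ_ne_zero,
    if_neg (by omega), narSeries, PowerSeries.coeff_mk, add_zero, sub_zero]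

theorem narPoly_rec (k : ℕ) : ((k : ℚ[X]) + 3) * narPoly (k + 2) =
    (2 * (k : ℚ[X]) + 3) * (1 + X) * narPoly (k + 1) - (k : ℚ[X]) * (1 - X) ^ 2 * narPoly k := by
  have h := congrArg (PowerSeries.coeff (k + 2)) narRoot_deriv
  set d := PowerSeries.derivative ℚ[X] narRoot with hd
  rw [show (1 - 2 * PowerSeries.C (1 + X) * PowerSeries.X +
      PowerSeries.C (1 - X) ^ 2 * PowerSeries.X ^ 2) * d =
      d - PowerSeries.C (2 * (1 + X)) * (PowerSeries.X * d) +
      PowerSeries.C ((1 - X) ^ 2) * (PowerSeries.X * (PowerSeries.X * d)) by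
      rw [map_mul, map_pow, map_ofNat]; ring,
    show (-PowerSeries.C (1 + X) + PowerSeries.C (1 - X) ^ 2 * PowerSeries.X) * narRoot =
      -(PowerSeries.C (1 + X) * narRoot) + PowerSeries.C ((1 - X) ^ 2) *
        (PowerSeries.X * narRoot) by rw [map_pow]; ring] at h
  generalize hp : (1 + X : ℚ[X]) = p at h ⊢
  simp only [map_add, map_sub, map_neg, PowerSeries.coeff_C_mul, PowerSeries.coeff_succ_X_mul, hd,
    PowerSeries.coeff_derivative, coeff_narRoot] at h
  have e : (k : ℚ[X]) * PowerSeries.coeff (k + 1) narRoot =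
      (k : ℚ[X]) * (2 * X * narPoly k) := by
    cases k with
    | zero => simp
    | succ k => rw [coeff_narRoot]
  refine mul_left_cancel₀ (mul_ne_zero two_ne_zero X_ne_zero : (2 * X : ℚ[X]) ≠ 0) ?_
  push_cast at h
  linear_combination h - (1 - X) ^ 2 * e

/-- The reciprocal of the factorial, extended by zero to negative integers. -/
def invFact (j : ℤ) : ℚ := if j < 0 then 0 else ((j.toNat).factorial : ℚ)⁻¹

theorem invFact_sub_one (j : ℤ) : invFact (j - 1) = j * invFact j := by
  unfold invFact
  rcases lt_trichotomy j 0 with h | rfl | h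
  · rw [if_pos (by omega), if_pos h, mul_zero]
  · simp
  · obtain ⟨k, rfl⟩ : ∃ k : ℕ, j = k + 1 := ⟨(j - 1).toNat, by omega⟩
    rw [if_neg (by omega), if_neg (by omega), show ((k : ℤ) + 1 - 1).toNat = k by omega,
      show ((k : ℤ) + 1).toNat = k + 1 by omega, Nat.factorial_succ]
    have : ((k : ℚ) + 1) ≠ 0 := by positivity
    push_cast
    field_simp

theorem invFact_natCast (k : ℕ) : invFact k = (k.factorial : ℚ)⁻¹ := by
  simp [invFact]

theorem invFact_of_neg {j : ℤ} (hj : j < 0) : invFact j = 0 := if_pos hj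

theorem choose_eq_invFact (k l : ℕ) :
    (k.choose l : ℚ) = k.factorial * invFact l * invFact (k - l) := by
  rcases le_or_gt l k with h | h
  · rw [← Nat.cast_sub h, invFact_natCast, invFact_natCast, Nat.cast_choose ℚ h]
    field_simp
  · rw [Nat.choose_eq_zero_of_lt h, invFact_of_neg (by omega : (k : ℤ) - l < 0)]
    simp

/-- The product `C(k, l) * C(k, l + 1)`, for an arbitrary integer `l`. -/
def chooseProd (k : ℕ) (l : ℤ) : ℚ :=
  (k.factorial : ℚ) ^ 2 * invFact l * invFact (l + 1) * invFact (k - l) * invFact (k - l - 1)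

theorem chooseProd_natCast (k l : ℕ) : chooseProd k l = k.choose l * k.choose (l + 1) := by
  rw [chooseProd, choose_eq_invFact, choose_eq_invFact]
  push_cast
  rw [sub_add_eq_sub_sub]
  ring

theorem chooseProd_of_neg (k : ℕ) {l : ℤ} (hl : l < 0) : chooseProd k l = 0 := by
  rw [chooseProd, invFact_of_neg hl]
  ring

theorem chooseProd_rec (k : ℕ) (l : ℤ) :
    ((k : ℚ) + 3) * (k + 1) * chooseProd (k + 2) l =
      (2 * k + 3) * (k + 2) * (chooseProd (k + 1) l + chooseProd (k + 1) (l - 1)) -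
      (k + 1) * (k + 2) * (chooseProd k l - 2 * chooseProd k (l - 1) + chooseProd k (l - 2)) := by
  unfold chooseProd
  have a1 := invFact_sub_one (l + 1)
  have a2 := invFact_sub_one l
  have a3 := invFact_sub_one (l - 1)
  have b1 := invFact_sub_one (k + 2 - l)
  have b2 := invFact_sub_one (k + 1 - l)
  have b3 := invFact_sub_one (k - l)
  rw [add_sub_cancel_right] at a1
  rw [show l - 1 - 1 = l - 2 by ring] at a3
  rw [show (k : ℤ) + 2 - l - 1 = k + 1 - l by ring] at b1
  rw [show (k : ℤ) + 1 - l - 1 = k - l by ring] at b2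
  have e1 : ((k + 2 : ℕ) : ℤ) - l = k + 2 - l := by push_cast; ring
  have e2 : ((k + 1 : ℕ) : ℤ) - l = k + 1 - l := by push_cast; ring
  have e3 : ((k + 1 : ℕ) : ℤ) - (l - 1) = k + 2 - l := by push_cast; ring
  have e4 : (k : ℤ) - (l - 1) = k + 1 - l := by ring
  have e5 : (k : ℤ) - (l - 2) = k + 2 - l := by ring
  have e6 : l - 2 + 1 = l - 1 := by ring
  have c1 : (k : ℤ) + 2 - l - 1 = k + 1 - l := by ring
  have c2 : (k : ℤ) + 1 - l - 1 = k - l := by ring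
  rw [e1, e2, e3, e4, e5, e6, c1, c2, sub_add_cancel, b3, b2, b1, a3, a2, a1, Nat.factorial_succ,
    Nat.factorial_succ]
  push_cast
  ring

theorem coeff_narPoly_aux (k : ℕ) : ∀ l : ℕ, (k : ℚ) * (narPoly k).coeff l = chooseProd k l := by
  induction k using Nat.strong_induction_on with
  | _ k ih =>
  intro l
  rcases k with _ | _ | k
  · rw [chooseProd_natCast]
    simp
  · have h1 : narPoly 1 = 1 := by simp [narPoly]
    rw [chooseProd_natCast, zero_add, h1, coeff_one]
    rcases l with _ | l
    · simp
    · simp [Nat.choose_eq_zero_of_lt (by omega : 1 < l + 1 + 1)]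
  · have h := congrArg (fun p => coeff p l) (narPoly_rec k)
    have i0 := ih k (by omega)
    have i1 := ih (k + 1) (by omega)
    have r := chooseProd_rec k l
    have pos : ((k : ℚ) + 3) * (k + 1) ≠ 0 := by positivity
    refine mul_left_cancel₀ pos ?_
    rw [r]
    rw [show ((k : ℚ[X]) + 3) * narPoly (k + 2) = C ((k : ℚ) + 3) * narPoly (k + 2) by
        rw [map_add, map_natCast, map_ofNat],
      show (2 * (k : ℚ[X]) + 3) * (1 + X) * narPoly (k + 1) -
        (k : ℚ[X]) * (1 - X) ^ 2 * narPoly k =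
        C (2 * (k : ℚ) + 3) * (narPoly (k + 1) + X * narPoly (k + 1)) -
        C (k : ℚ) * (narPoly k - C 2 * (X * narPoly k) + X * (X * narPoly k)) by
        simp only [map_add, map_mul, map_natCast, map_ofNat]; ring] at h
    simp only [coeff_sub, coeff_C_mul, coeff_add] at h
    push_cast at i1 ⊢
    rcases l with _ | _ | l
    · simp only [mul_coeff_zero, coeff_X_zero, zero_mul] at h
      rw [chooseProd_of_neg (k + 1) (l := (0 : ℕ) - 1) (by simp),
        chooseProd_of_neg k (l := (0 : ℕ) - 1) (by simp),
        chooseProd_of_neg k (l := (0 : ℕ) - 2) (by simp), ← i0, ← i1]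
      linear_combination (k + 1) * (k + 2) * h
    · simp only [zero_add, coeff_X_mul, coeff_X_mul_zero] at h
      rw [zero_add, chooseProd_of_neg k (l := (1 : ℕ) - 2) (by simp),
        show ((1 : ℕ) : ℤ) - 1 = (0 : ℕ) by simp, ← i0, ← i1, ← i0, ← i1]
      linear_combination (k + 1) * (k + 2) * h
    · simp only [coeff_X_mul] at h
      rw [show ((l + 1 + 1 : ℕ) : ℤ) - 1 = (l + 1 : ℕ) by push_cast; ring,
        show ((l + 1 + 1 : ℕ) : ℤ) - 2 = (l : ℕ) by push_cast; ring, ← i0, ← i1, ← i0, ← i1, ← i0]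
      linear_combination (k + 1) * (k + 2) * h

theorem coeff_narPoly (k l : ℕ) :
    (k : ℚ) * (narPoly k).coeff l = k.choose l * k.choose (l + 1) := by
  rw [coeff_narPoly_aux, chooseProd_natCast]

end ClosedForm

section Polygon

variable {n : ℕ} {D U : Finset ℕ}

/-- A key giving the order of `pos`. -/
def posKey (n : ℕ) (U : Finset ℕ) (v : ℕ) : ℕ := if v ∈ U then 2 * n + 5 - v else v

theorem mem_or_mem (hUD : D ∪ U = Finset.Icc 1 (n + 1)) {v : ℕ} (hv : v ≤ n + 2) :
    v = 0 ∨ v = n + 2 ∨ v ∈ D ∨ v ∈ U := by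
  by_contra! h
  have : v ∈ D ∪ U := by rw [hUD, Finset.mem_Icc]; omega
  rw [Finset.mem_union] at this
  tauto

theorem pos_of_mem_down (hUD : D ∪ U = Finset.Icc 1 (n + 1)) {v : ℕ} (hv : v ∈ D) :
    (1 ≤ v ∧ v ≤ n + 1) ∧ pos n D U v = 1 + (D.filter (fun d => d < v)).card := by
  have h : v ∈ Finset.Icc 1 (n + 1) := hUD ▸ Finset.mem_union_left _ hv
  rw [Finset.mem_Icc] at h
  exact ⟨h, by rw [pos, if_neg (by omega), if_neg (by omega), if_pos hv]⟩

theorem pos_of_mem_up (hUD : D ∪ U = Finset.Icc 1 (n + 1)) (hdisj : Disjoint D U) {v : ℕ}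
    (hv : v ∈ U) :
    (1 ≤ v ∧ v ≤ n + 1) ∧ pos n D U v = D.card + 2 + (U.filter (fun w => v < w)).card := by
  have h : v ∈ Finset.Icc 1 (n + 1) := hUD ▸ Finset.mem_union_right _ hv
  rw [Finset.mem_Icc] at h
  exact ⟨h, by rw [pos, if_neg (by omega), if_neg (by omega),
    if_neg (Finset.disjoint_right.1 hdisj hv)]⟩

theorem card_add_card (hUD : D ∪ U = Finset.Icc 1 (n + 1)) (hdisj : Disjoint D U) :
    D.card + U.card = n + 1 := by
  rw [← Finset.card_union_of_disjoint hdisj, hUD, Nat.card_Icc]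
  rfl

theorem card_filter_lt_of_mem {A : Finset ℕ} {p : ℕ → Prop} [DecidablePred p] {v : ℕ}
    (hv : v ∈ A) (hp : ¬ p v) :
    (A.filter p).card < A.card :=
  Finset.card_lt_card ⟨Finset.filter_subset _ _, fun h => hp (Finset.mem_filter.1 (h hv)).2⟩

theorem card_filter_lt_card_filter {A : Finset ℕ} {p q : ℕ → Prop} [DecidablePred p]
    [DecidablePred q] (h : ∀ x, p x → q x) {v : ℕ} (hv : v ∈ A) (hp : ¬ p v) (hq : q v) :
    (A.filter p).card < (A.filter q).card := by
  refine Finset.card_lt_card ⟨fun x hx => ?_, fun h => hp (Finset.mem_filter.1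
    (h (Finset.mem_filter.2 ⟨hv, hq⟩))).2⟩
  rw [Finset.mem_filter] at *
  exact ⟨hx.1, h x hx.2⟩

theorem pos_zero : pos n D U 0 = 0 := if_pos rfl

theorem pos_last : pos n D U (n + 2) = D.card + 1 := by simp [pos]

theorem pos_le (hUD : D ∪ U = Finset.Icc 1 (n + 1)) (hdisj : Disjoint D U) {v : ℕ}
    (hv : v ≤ n + 2) : pos n D U v ≤ n + 2 := by
  have hc := card_add_card hUD hdisj
  rcases mem_or_mem hUD hv with rfl | rfl | h | h
  · simp [pos_zero]
  · rw [pos_last]; omega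
  · rw [(pos_of_mem_down hUD h).2]
    have := card_filter_lt_of_mem (p := fun d => d < v) h (lt_irrefl v)
    omega
  · rw [(pos_of_mem_up hUD hdisj h).2]
    have := card_filter_lt_of_mem (p := fun d => v < d) h (lt_irrefl v)
    omega

theorem pos_lt_pos (hUD : D ∪ U = Finset.Icc 1 (n + 1)) (hdisj : Disjoint D U) {v w : ℕ}
    (hv : v ≤ n + 2) (hw : w ≤ n + 2) (h : posKey n U v < posKey n U w) :
    pos n D U v < pos n D U w := by
  have h0 : (0 : ℕ) ∉ U := fun h => by have := (pos_of_mem_up hUD hdisj h).1; omega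
  have hl : n + 2 ∉ U := fun h => by have := (pos_of_mem_up hUD hdisj h).1; omega
  have hd : ∀ {x}, x ∈ D → x ∉ U := fun hx => Finset.disjoint_left.1 hdisj hx
  have key : ∀ {x}, x ∈ U → posKey n U x = 2 * n + 5 - x := fun hx => if_pos hx
  have key' : ∀ {x}, x ∉ U → posKey n U x = x := fun hx => if_neg hx
  rcases mem_or_mem hUD hv with rfl | rfl | hv' | hv' <;>
    rcases mem_or_mem hUD hw with rfl | rfl | hw' | hw'
  · omega
  · rw [pos_zero, pos_last]; omega
  · rw [pos_zero, (pos_of_mem_down hUD hw').2]; omega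
  · rw [pos_zero, (pos_of_mem_up hUD hdisj hw').2]; omega
  · rw [key' h0, key' hl] at h; omega
  · omega
  · have := (pos_of_mem_down hUD hw').1
    rw [key' hl, key' (hd hw')] at h; omega
  · rw [pos_last, (pos_of_mem_up hUD hdisj hw').2]; omega
  · rw [key' h0] at h; omega
  · rw [pos_last, (pos_of_mem_down hUD hv').2]
    have := card_filter_lt_of_mem (p := fun d => d < v) hv' (lt_irrefl v)
    omega
  · rw [key' (hd hv'), key' (hd hw')] at h
    rw [(pos_of_mem_down hUD hv').2, (pos_of_mem_down hUD hw').2]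
    exact Nat.add_lt_add_left (card_filter_lt_card_filter (p := fun d => d < v)
      (q := fun d => d < w) (fun x hx => hx.trans h) hv' (lt_irrefl v) h) 1
  · rw [(pos_of_mem_down hUD hv').2, (pos_of_mem_up hUD hdisj hw').2]
    have := card_filter_lt_of_mem (p := fun d => d < v) hv' (lt_irrefl v)
    omega
  · rw [key' h0] at h; omega
  · have := (pos_of_mem_up hUD hdisj hv').1
    rw [key hv', key' hl] at h; omega
  · have := (pos_of_mem_up hUD hdisj hv').1
    have := (pos_of_mem_down hUD hw').1
    rw [key hv', key' (hd hw')] at h; omega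
  · have := (pos_of_mem_up hUD hdisj hv').1
    have := (pos_of_mem_up hUD hdisj hw').1
    rw [key hv', key hw'] at h
    have hwv : w < v := by omega
    rw [(pos_of_mem_up hUD hdisj hv').2, (pos_of_mem_up hUD hdisj hw').2]
    exact Nat.add_lt_add_left (card_filter_lt_card_filter (p := fun x => v < x)
      (q := fun x => w < x) (fun x hx => hwv.trans hx) hv' (lt_irrefl v) hwv) _

theorem posKey_inj (hUD : D ∪ U = Finset.Icc 1 (n + 1)) (hdisj : Disjoint D U) {v w : ℕ}
    (hv : v ≤ n + 2) (hw : w ≤ n + 2) (h : posKey n U v = posKey n U w) : v = w := by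
  unfold posKey at h
  split_ifs at h with h1 h2 h2
  · have := (pos_of_mem_up hUD hdisj h1).1
    have := (pos_of_mem_up hUD hdisj h2).1
    omega
  · have := (pos_of_mem_up hUD hdisj h1).1
    omega
  · have := (pos_of_mem_up hUD hdisj h2).1
    omega
  · exact h

theorem pos_lt_iff (hUD : D ∪ U = Finset.Icc 1 (n + 1)) (hdisj : Disjoint D U) {v w : ℕ}
    (hv : v ≤ n + 2) (hw : w ≤ n + 2) :
    pos n D U v < pos n D U w ↔ posKey n U v < posKey n U w := by
  refine ⟨fun h => ?_, pos_lt_pos hUD hdisj hv hw⟩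
  rcases lt_trichotomy (posKey n U v) (posKey n U w) with h' | h' | h'
  · exact h'
  · rw [posKey_inj hUD hdisj hv hw h'] at h
    omega
  · have := pos_lt_pos hUD hdisj hw hv h'
    omega

theorem relpos_eq (hUD : D ∪ U = Finset.Icc 1 (n + 1)) (hdisj : Disjoint D U) {a v : ℕ}
    (ha : a ≤ n + 2) (hv : v ≤ n + 2) :
    relpos n D U a v = if pos n D U a ≤ pos n D U v then pos n D U v - pos n D U a
      else pos n D U v + (n + 3) - pos n D U a := by
  have h1 := pos_le hUD hdisj ha
  have h2 := pos_le hUD hdisj hv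
  unfold relpos
  split_ifs with h
  · rw [show pos n D U v + (n + 3) - pos n D U a = pos n D U v - pos n D U a + (n + 3) by omega,
      Nat.add_mod_right, Nat.mod_eq_of_lt (by omega)]
  · rw [Nat.mod_eq_of_lt (by omega)]

theorem strictBetween_iff (hUD : D ∪ U = Finset.Icc 1 (n + 1)) (hdisj : Disjoint D U) {a b v : ℕ}
    (ha : a ≤ n + 2) (hb : b ≤ n + 2) : StrictBetween n D U a b v ↔
      v ≤ n + 2 ∧ ccwKey (· ∈ U) (n + 2) a a < ccwKey (· ∈ U) (n + 2) a v ∧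
        ccwKey (· ∈ U) (n + 2) a v < ccwKey (· ∈ U) (n + 2) a b := by
  unfold StrictBetween
  refine and_congr_right fun hv => ?_
  rw [relpos_eq hUD hdisj ha hv, relpos_eq hUD hdisj ha hb]
  have h1 := pos_lt_iff hUD hdisj ha hv
  have h2 := pos_lt_iff hUD hdisj hv ha
  have h3 := pos_lt_iff hUD hdisj hb hv
  have h4 := pos_lt_iff hUD hdisj hv hb
  have h5 := pos_lt_iff hUD hdisj ha hb
  have h6 := pos_lt_iff hUD hdisj hb ha
  have h7 := pos_le hUD hdisj ha
  have h8 := pos_le hUD hdisj hb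
  have h9 := pos_le hUD hdisj hv
  have hU : ∀ x ∈ U, 1 ≤ x ∧ x ≤ n + 1 := fun x hx => (pos_of_mem_up hUD hdisj hx).1
  unfold ccwKey linKey
  unfold posKey at h1 h2 h3 h4 h5 h6
  have e1 := hU a
  have e2 := hU b
  have e3 := hU v
  clear hU
  by_cases a1 : a ∈ U <;> by_cases a2 : b ∈ U <;> by_cases a3 : v ∈ U <;>
    simp only [a1, a2, a3, if_true, if_false, forall_true_left, false_imp_iff] at * <;>
    split_ifs <;> omega

theorem strictBetween_swap (hUD : D ∪ U = Finset.Icc 1 (n + 1)) (hdisj : Disjoint D U)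
    {a b v : ℕ} (ha : a ≤ n + 2) (hb : b ≤ n + 2) (hab : a ≠ b) : StrictBetween n D U b a v ↔
      v ≤ n + 2 ∧ ccwKey (· ∈ U) (n + 2) a b < ccwKey (· ∈ U) (n + 2) a v := by
  rw [strictBetween_iff hUD hdisj hb ha]
  refine and_congr_right fun hv => ?_
  have hU : ∀ x ∈ U, 1 ≤ x ∧ x ≤ n + 1 := fun x hx => (pos_of_mem_up hUD hdisj hx).1
  unfold ccwKey linKey
  have e1 := hU a
  have e2 := hU b
  have e3 := hU v
  clear hU
  by_cases a1 : a ∈ U <;> by_cases a2 : b ∈ U <;> by_cases a3 : v ∈ U <;>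
    simp only [a1, a2, a3, if_true, if_false, forall_true_left, false_imp_iff] at * <;>
    split_ifs <;> omega

end Polygon

section Translation

variable {n : ℕ} {D U : Finset ℕ}

theorem strictBetween_iff_below (hUD : D ∪ U = Finset.Icc 1 (n + 1)) (hdisj : Disjoint D U)
    {a b v : ℕ} (hab : a < b) (hb : b ≤ n + 2) :
    StrictBetween n D U a b v ↔ v ≤ n + 2 ∧ Below (· ∈ U) a b v := by
  rw [strictBetween_iff hUD hdisj (by omega) hb]
  exact and_congr_right fun hv => (below_iff_ccwKey hab hb hv).symm

theorem strictBetween_iff_above (hUD : D ∪ U = Finset.Icc 1 (n + 1)) (hdisj : Disjoint D U)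
    {a b v : ℕ} (hab : a < b) (hb : b ≤ n + 2) :
    StrictBetween n D U b a v ↔ v ≤ n + 2 ∧ Above (· ∈ U) a b v := by
  rw [strictBetween_swap hUD hdisj (by omega) hb hab.ne]
  exact and_congr_right fun hv => (above_iff_ccwKey hab hb hv).symm

theorem pos_inj (hUD : D ∪ U = Finset.Icc 1 (n + 1)) (hdisj : Disjoint D U) {v w : ℕ}
    (hv : v ≤ n + 2) (hw : w ≤ n + 2) (h : pos n D U v = pos n D U w) : v = w := by
  rcases lt_trichotomy (posKey n U v) (posKey n U w) with h' | h' | h'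
  · exact absurd h (pos_lt_pos hUD hdisj hv hw h').ne
  · exact posKey_inj hUD hdisj hv hw h'
  · exact absurd h (pos_lt_pos hUD hdisj hw hv h').ne'

theorem exists_relpos_eq_one (hUD : D ∪ U = Finset.Icc 1 (n + 1)) (hdisj : Disjoint D U) {a : ℕ}
    (ha : a ≤ n + 2) : ∃ v ≤ n + 2, relpos n D U a v = 1 := by
  have hinj : Set.InjOn (relpos n D U a) (Finset.range (n + 3)) := by
    intro v hv w hw h
    simp only [Finset.coe_range, Set.mem_Iio] at hv hw
    rw [relpos_eq hUD hdisj ha (by omega), relpos_eq hUD hdisj ha (by omega)] at h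
    have h1 := pos_le hUD hdisj ha
    have h2 := pos_le hUD hdisj (v := v) (by omega)
    have h3 := pos_le hUD hdisj (v := w) (by omega)
    refine pos_inj hUD hdisj (by omega) (by omega) ?_
    split_ifs at h <;> omega
  have hmaps : Set.MapsTo (relpos n D U a) (Finset.range (n + 3)) (Finset.range (n + 3)) :=
    fun v _ => Finset.mem_coe.2 (Finset.mem_range.2 (Nat.mod_lt _ (Nat.succ_pos _)))
  obtain ⟨v, hv, h⟩ := Finset.surj_on_of_inj_on_of_card_le (fun v _ => relpos n D U a v)
    (fun v hv => hmaps hv) (fun v w hv hw h => hinj hv hw h) le_rfl 1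
    (Finset.mem_range.2 (by omega))
  exact ⟨v, by rw [Finset.mem_range] at hv; omega, h.symm⟩

theorem relpos_eq_one_iff (hUD : D ∪ U = Finset.Icc 1 (n + 1)) (hdisj : Disjoint D U) {a b : ℕ}
    (ha : a ≤ n + 2) (hb : b ≤ n + 2) (hab : a ≠ b) :
    relpos n D U a b = 1 ↔ ∀ v, ¬ StrictBetween n D U a b v := by
  constructor
  · intro h v hv
    have := hv.2
    omega
  · intro h
    obtain ⟨v, hv, hv1⟩ := exists_relpos_eq_one hUD hdisj ha
    have h1 := h v
    simp only [StrictBetween, hv, hv1, true_and, not_lt, zero_lt_one] at h1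
    have h2 : relpos n D U a b ≠ 0 := by
      intro h0
      rw [relpos_eq hUD hdisj ha hb] at h0
      have h1 := pos_le hUD hdisj ha
      have h2 := pos_le hUD hdisj hb
      exact hab (pos_inj hUD hdisj ha hb (by split_ifs at h0 <;> omega))
    omega

theorem mem_pairs_range {δ : ℕ × ℕ} :
    δ ∈ pairs (Finset.range (n + 3)) ↔ δ.1 < δ.2 ∧ δ.2 ≤ n + 2 := by
  rw [mem_pairs, Finset.mem_range, Finset.mem_range]
  omega

/-- The boundary edges of the polygon. -/
def boundary (n : ℕ) (D U : Finset ℕ) : Finset (ℕ × ℕ) :=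
  (pairs (Finset.range (n + 3))).filter (IsBoundaryEdge n D U)

theorem mem_boundary {δ : ℕ × ℕ} : δ ∈ boundary n D U ↔ IsBoundaryEdge n D U δ := by
  rw [boundary, Finset.mem_filter, mem_pairs_range]
  exact and_iff_right_of_imp fun h => h.1

theorem mem_boundary_iff (hUD : D ∪ U = Finset.Icc 1 (n + 1)) (hdisj : Disjoint D U)
    {δ : ℕ × ℕ} (hδ : δ ∈ pairs (Finset.range (n + 3))) :
    δ ∈ boundary n D U ↔ (∀ v ∈ Finset.range (n + 3), ¬ Below (· ∈ U) δ.1 δ.2 v) ∨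
      ∀ v ∈ Finset.range (n + 3), ¬ Above (· ∈ U) δ.1 δ.2 v := by
  rw [mem_pairs_range] at hδ
  rw [mem_boundary, IsBoundaryEdge, IsDiag, and_iff_right hδ,
    relpos_eq_one_iff hUD hdisj (by omega) hδ.2 hδ.1.ne,
    relpos_eq_one_iff hUD hdisj hδ.2 (by omega) hδ.1.ne']
  simp only [strictBetween_iff_below hUD hdisj hδ.1 hδ.2,
    strictBetween_iff_above hUD hdisj hδ.1 hδ.2, not_and, Finset.mem_range, Nat.lt_succ_iff]

theorem isInternalDiag_iff {δ : ℕ × ℕ} : IsInternalDiag n D U δ ↔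
    δ ∈ pairs (Finset.range (n + 3)) ∧ δ ∉ boundary n D U := by
  rw [mem_boundary, mem_pairs_range]
  rfl

theorem cross_iff (hUD : D ∪ U = Finset.Icc 1 (n + 1)) (hdisj : Disjoint D U) {δ δ' : ℕ × ℕ}
    (hδ : δ ∈ pairs (Finset.range (n + 3))) (hδ' : δ' ∈ pairs (Finset.range (n + 3))) :
    Cross n D U δ δ' ↔ Crs (· ∈ U) δ δ' := by
  obtain ⟨a, b⟩ := δ
  obtain ⟨c, d⟩ := δ'
  rw [mem_pairs_range] at hδ hδ'
  simp only at hδ hδ'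
  have hd := hδ'.2
  have hc : c ≤ n + 2 := by omega
  simp only [Cross, Crs, strictBetween_iff_below hUD hdisj hδ.1 hδ.2,
    strictBetween_iff_above hUD hdisj hδ.1 hδ.2, hc, hd, true_and]
  refine ⟨fun h => by tauto, fun h => ⟨hδ.1.ne, hδ'.1.ne, ?_, ?_, ?_, ?_, by tauto⟩⟩ <;>
    rintro rfl <;>
    simp [not_below_left, not_below_right, not_above_left, not_above_right, hδ.1] at h

theorem Crs.symm {u : ℕ → Prop} {δ δ' : ℕ × ℕ} (hδ : δ ∈ pairs (Finset.range (n + 3)))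
    (hδ' : δ' ∈ pairs (Finset.range (n + 3))) (h : Crs u δ δ') : Crs u δ' δ := by
  have hk := isKey_ccwKey (u := u) (K := n + 2) (a := 0) (S := Finset.range (n + 3))
    (by simp) (fun v hv => by rw [Finset.mem_range] at hv; omega)
  obtain ⟨h1, h2, h3⟩ := mem_pairs.1 hδ
  obtain ⟨h4, h5, h6⟩ := mem_pairs.1 hδ'
  have h := (hk.crs_iff _ h1 _ h2 _ h4 _ h5 h3 h6).1 h
  refine (hk.crs_iff _ h4 _ h5 _ h1 _ h2 h6 h3).2 ?_
  unfold Interleave at *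
  omega

theorem not_crs_boundary (hUD : D ∪ U = Finset.Icc 1 (n + 1)) (hdisj : Disjoint D U)
    {δ δ' : ℕ × ℕ} (hδ : δ ∈ boundary n D U) (hδ' : δ' ∈ pairs (Finset.range (n + 3))) :
    ¬ Crs (· ∈ U) δ δ' := by
  obtain ⟨h1, h2, -⟩ := mem_pairs.1 hδ'
  have := (mem_boundary_iff hUD hdisj (Finset.mem_filter.1 hδ).1).1 hδ
  rintro (h | h) <;> rcases this with h' | h'
  · exact h' _ h1 h.1
  · exact h' _ h2 h.2
  · exact h' _ h2 h.2
  · exact h' _ h1 h.1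

theorem mem_allTri {T : Finset (ℕ × ℕ)} : T ∈ allTri n D U ↔ IsTriangulation n D U T := by
  simp only [allTri, Finset.mem_filter, Finset.mem_powerset, and_iff_right_iff_imp]
  intro h δ hδ
  obtain ⟨h1, h2⟩ := (h.1 δ hδ).1
  simp only [Finset.mem_filter, Finset.mem_product, Finset.mem_range]
  exact ⟨⟨by omega, by omega⟩, h.1 δ hδ⟩

theorem union_boundary_mem_Tri (hUD : D ∪ U = Finset.Icc 1 (n + 1)) (hdisj : Disjoint D U)
    {T : Finset (ℕ × ℕ)} (hT : IsTriangulation n D U T) :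
    T ∪ boundary n D U ∈ Tri (· ∈ U) (Finset.range (n + 3)) := by
  have hTp : ∀ δ ∈ T, δ ∈ pairs (Finset.range (n + 3)) :=
    fun δ hδ => (isInternalDiag_iff.1 (hT.1 δ hδ)).1
  have hBp : ∀ δ ∈ boundary n D U, δ ∈ pairs (Finset.range (n + 3)) :=
    fun δ hδ => (Finset.mem_filter.1 hδ).1
  refine mem_Tri.2 ⟨Finset.union_subset hTp hBp, fun δ hδ => ⟨fun h δ' h' => ?_, fun h => ?_⟩⟩
  · rcases Finset.mem_union.1 h with h | h
    · rcases Finset.mem_union.1 h' with h' | h'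
      · rw [← cross_iff hUD hdisj hδ (hTp _ h')]
        exact hT.2.1 δ h δ' h'
      · exact fun hc => not_crs_boundary hUD hdisj h' hδ (hc.symm hδ (hBp _ h'))
    · exact not_crs_boundary hUD hdisj h
        ((Finset.mem_union.1 h').elim (hTp _) (hBp _))
  · by_contra hn
    rw [Finset.mem_union, not_or] at hn
    obtain ⟨δ', h', hc⟩ := hT.2.2 δ (isInternalDiag_iff.2 ⟨hδ, hn.2⟩) hn.1
    exact h δ' (Finset.mem_union_left _ h') ((cross_iff hUD hdisj hδ (hTp _ h')).1 hc)

theorem boundary_subset (hUD : D ∪ U = Finset.Icc 1 (n + 1)) (hdisj : Disjoint D U)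
    {E : Finset (ℕ × ℕ)} (hE : E ∈ Tri (· ∈ U) (Finset.range (n + 3))) :
    boundary n D U ⊆ E := fun δ hδ =>
  ((mem_Tri.1 hE).2 δ (Finset.mem_filter.1 hδ).1).2 fun _ h' =>
    not_crs_boundary hUD hdisj hδ ((mem_Tri.1 hE).1 h')

theorem isTriangulation_sdiff (hUD : D ∪ U = Finset.Icc 1 (n + 1)) (hdisj : Disjoint D U)
    {E : Finset (ℕ × ℕ)} (hE : E ∈ Tri (· ∈ U) (Finset.range (n + 3))) :
    IsTriangulation n D U (E \ boundary n D U) := by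
  obtain ⟨hp, hE'⟩ := mem_Tri.1 hE
  refine ⟨fun δ hδ => ?_, fun δ hδ δ' hδ' => ?_, fun δ hδ hn => ?_⟩
  · rw [Finset.mem_sdiff] at hδ
    exact isInternalDiag_iff.2 ⟨hp hδ.1, hδ.2⟩
  · rw [Finset.mem_sdiff] at hδ hδ'
    rw [cross_iff hUD hdisj (hp hδ.1) (hp hδ'.1)]
    exact (hE' δ (hp hδ.1)).1 hδ.1 δ' hδ'.1
  · rw [isInternalDiag_iff] at hδ
    have h : δ ∉ E := fun h => hn (Finset.mem_sdiff.2 ⟨h, hδ.2⟩)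
    rw [hE' δ hδ.1] at h
    push Not at h
    obtain ⟨δ', h', hc⟩ := h
    refine ⟨δ', Finset.mem_sdiff.2 ⟨h', fun hb => ?_⟩, (cross_iff hUD hdisj hδ.1 (hp h')).2 hc⟩
    exact not_crs_boundary hUD hdisj hb hδ.1 (hc.symm hδ.1 (hp h'))

theorem edgeOf_iff {T : Finset (ℕ × ℕ)} {a b : ℕ} :
    EdgeOf n D U T a b ↔ (a, b) ∈ T ∪ boundary n D U := by
  rw [EdgeOf, Finset.mem_union, mem_boundary]

theorem adj_iff_of_lt {u : ℕ → Prop} {S : Finset ℕ} {E : Finset (ℕ × ℕ)} (hE : E ∈ Tri u S)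
    {a b : ℕ} (hab : a < b) : Adj E a b ↔ (a, b) ∈ E := by
  refine ⟨fun h => h.resolve_right fun h => ?_, Or.inl⟩
  have := (mem_pairs.1 ((mem_Tri.1 hE).1 h)).2.2
  exact absurd this hab.asymm

theorem triWith_iff (hUD : D ∪ U = Finset.Icc 1 (n + 1)) (hdisj : Disjoint D U)
    {T : Finset (ℕ × ℕ)} (hT : IsTriangulation n D U T) {δ : ℕ × ℕ} (hδ : δ ∈ T) {c : ℕ}
    (hc : c ≤ n + 2) (h1 : c ≠ δ.1) (h2 : c ≠ δ.2) : TriWith n D U T δ c ↔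
      Adj (T ∪ boundary n D U) c δ.1 ∧ Adj (T ∪ boundary n D U) c δ.2 := by
  have hE := union_boundary_mem_Tri hUD hdisj hT
  have hδE : (δ.1, δ.2) ∈ T ∪ boundary n D U := Finset.mem_union_left _ hδ
  obtain ⟨hlt, hle⟩ := mem_pairs_range.1 ((mem_Tri.1 hE).1 hδE)
  simp only at hlt hle
  unfold TriWith IsTriangleOf
  simp only [edgeOf_iff]
  split_ifs with h3 h4
  · rw [adj_iff_of_lt hE h3, adj_iff_of_lt hE (h3.trans hlt)]
    tauto
  · have h5 : δ.1 < c := by omega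
    rw [show Adj (T ∪ boundary n D U) c δ.1 ↔ _ from ⟨Adj.symm, Adj.symm⟩, adj_iff_of_lt hE h5,
      adj_iff_of_lt hE h4]
    tauto
  · have h5 : δ.2 < c := by omega
    rw [show Adj (T ∪ boundary n D U) c δ.1 ↔ _ from ⟨Adj.symm, Adj.symm⟩,
      show Adj (T ∪ boundary n D U) c δ.2 ↔ _ from ⟨Adj.symm, Adj.symm⟩, adj_iff_of_lt hE h5,
      adj_iff_of_lt hE (hlt.trans h5)]
    tauto

theorem midOf_eq_clamp {δ : ℕ × ℕ} (h : δ.1 < δ.2) (c : ℕ) : midOf δ.1 δ.2 c = clamp δ c := by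
  unfold midOf clamp
  split_ifs <;> omega

theorem isKey_range (u : ℕ → Prop) {a : ℕ} (ha : a ≤ n + 2) :
    IsKey u (Finset.range (n + 3)) (ccwKey u (n + 2) a) :=
  isKey_ccwKey (Finset.mem_range.2 (by omega)) fun v hv => by rw [Finset.mem_range] at hv; omega

theorem strictBetween_triangle_unique (hUD : D ∪ U = Finset.Icc 1 (n + 1)) (hdisj : Disjoint D U)
    {E : Finset (ℕ × ℕ)} (hE : E ∈ Tri (· ∈ U) (Finset.range (n + 3))) {a b c d : ℕ}
    (ha : a ≤ n + 2) (hb : b ≤ n + 2) (hc : StrictBetween n D U a b c)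
    (hd : StrictBetween n D U a b d) (h1 : Adj E c a) (h2 : Adj E c b) (h3 : Adj E d a)
    (h4 : Adj E d b) : c = d := by
  rw [strictBetween_iff hUD hdisj ha hb] at hc hd
  exact triangle_unique (isKey_range _ ha) hE hc.2.1 hc.2.2 hd.2.1 hd.2.2 h1.symm h2 h3.symm h4

theorem exists_strictBetween_triangle (hUD : D ∪ U = Finset.Icc 1 (n + 1)) (hdisj : Disjoint D U)
    {E : Finset (ℕ × ℕ)} (hE : E ∈ Tri (· ∈ U) (Finset.range (n + 3))) {a b x : ℕ}
    (ha : a ≤ n + 2) (hb : b ≤ n + 2) (hab : Adj E a b) (hx : StrictBetween n D U a b x) :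
    ∃ c, StrictBetween n D U a b c ∧ Adj E c a ∧ Adj E c b := by
  have hx' := hx.1
  rw [strictBetween_iff hUD hdisj ha hb] at hx
  obtain ⟨c, h1, h2, h3, h4⟩ := exists_triangle (isKey_range _ ha) hE hab
    (Finset.mem_range.2 (by omega)) hx.2.1 hx.2.2
  have := Finset.mem_range.1 (h4.mem_left hE)
  exact ⟨c, (strictBetween_iff hUD hdisj ha hb).2 ⟨by omega, h1, h2⟩, h3.symm, h4⟩

theorem spineSrc_eq (hUD : D ∪ U = Finset.Icc 1 (n + 1)) (hdisj : Disjoint D U)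
    {T : Finset (ℕ × ℕ)} (hT : IsTriangulation n D U T) {δ : ℕ × ℕ} (hδ : δ ∈ T) {s : ℕ}
    (hs : Below (· ∈ U) δ.1 δ.2 s) (h1 : Adj (T ∪ boundary n D U) s δ.1)
    (h2 : Adj (T ∪ boundary n D U) s δ.2) : spineSrc n D U T δ = clamp δ s := by
  have hE := union_boundary_mem_Tri hUD hdisj hT
  obtain ⟨hlt, hle⟩ := mem_pairs_range.1 (isInternalDiag_iff.1 (hT.1 δ hδ)).1
  have key : ∀ c, StrictBetween n D U δ.1 δ.2 c ∧ TriWith n D U T δ c ↔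
      StrictBetween n D U δ.1 δ.2 c ∧ Adj (T ∪ boundary n D U) c δ.1 ∧
        Adj (T ∪ boundary n D U) c δ.2 := fun c => and_congr_right fun hc => by
    have hc' := (strictBetween_iff_below hUD hdisj hlt hle).1 hc
    refine triWith_iff hUD hdisj hT hδ hc.1 ?_ ?_ <;> rintro rfl
    exacts [not_below_left hlt hc'.2, not_below_right hlt hc'.2]
  have hsn : s ≤ n + 2 := by have := Finset.mem_range.1 (h1.mem_left hE); omega
  have hs' := (strictBetween_iff_below hUD hdisj hlt hle).2 ⟨hsn, hs⟩
  have hex : ∃ c, StrictBetween n D U δ.1 δ.2 c ∧ TriWith n D U T δ c :=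
    ⟨s, (key s).2 ⟨hs', h1, h2⟩⟩
  obtain ⟨h3, h4, h5⟩ := (key _).1 hex.choose_spec
  rw [spineSrc, dif_pos hex, midOf_eq_clamp hlt, strictBetween_triangle_unique hUD hdisj hE
    (by omega) hle h3 hs' h4 h5 h1 h2]

theorem spineTgt_eq (hUD : D ∪ U = Finset.Icc 1 (n + 1)) (hdisj : Disjoint D U)
    {T : Finset (ℕ × ℕ)} (hT : IsTriangulation n D U T) {δ : ℕ × ℕ} (hδ : δ ∈ T) {t : ℕ}
    (ht : Above (· ∈ U) δ.1 δ.2 t) (h1 : Adj (T ∪ boundary n D U) t δ.1)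
    (h2 : Adj (T ∪ boundary n D U) t δ.2) : spineTgt n D U T δ = clamp δ t := by
  have hE := union_boundary_mem_Tri hUD hdisj hT
  obtain ⟨hlt, hle⟩ := mem_pairs_range.1 (isInternalDiag_iff.1 (hT.1 δ hδ)).1
  have key : ∀ c, StrictBetween n D U δ.2 δ.1 c ∧ TriWith n D U T δ c ↔
      StrictBetween n D U δ.2 δ.1 c ∧ Adj (T ∪ boundary n D U) c δ.1 ∧
        Adj (T ∪ boundary n D U) c δ.2 := fun c => and_congr_right fun hc => by
    have hc' := (strictBetween_iff_above hUD hdisj hlt hle).1 hc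
    refine triWith_iff hUD hdisj hT hδ hc.1 ?_ ?_ <;> rintro rfl
    exacts [not_above_left hlt hc'.2, not_above_right hlt hc'.2]
  have htn : t ≤ n + 2 := by have := Finset.mem_range.1 (h1.mem_left hE); omega
  have ht' := (strictBetween_iff_above hUD hdisj hlt hle).2 ⟨htn, ht⟩
  have hex : ∃ c, StrictBetween n D U δ.2 δ.1 c ∧ TriWith n D U T δ c :=
    ⟨t, (key t).2 ⟨ht', h1, h2⟩⟩
  obtain ⟨h3, h4, h5⟩ := (key _).1 hex.choose_spec
  rw [spineTgt, dif_pos hex, midOf_eq_clamp hlt, strictBetween_triangle_unique hUD hdisj hE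
    hle (by omega) h3 ht' h5 h4 h2 h1]

theorem spineSrc_lt_spineTgt_iff (hUD : D ∪ U = Finset.Icc 1 (n + 1)) (hdisj : Disjoint D U)
    {T : Finset (ℕ × ℕ)} (hT : IsTriangulation n D U T) {δ : ℕ × ℕ} (hδ : δ ∈ T) :
    spineSrc n D U T δ < spineTgt n D U T δ ↔ Ordered (· ∈ U) (T ∪ boundary n D U) δ := by
  have hE := union_boundary_mem_Tri hUD hdisj hT
  obtain ⟨hp, hb⟩ := isInternalDiag_iff.1 (hT.1 δ hδ)
  obtain ⟨hlt, hle⟩ := mem_pairs_range.1 hp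
  rw [mem_boundary_iff hUD hdisj hp, not_or] at hb
  push Not at hb
  simp only [Finset.mem_range, Nat.lt_succ_iff] at hb
  obtain ⟨⟨x, hx⟩, y, hy⟩ := hb
  have hadj : Adj (T ∪ boundary n D U) δ.1 δ.2 := Or.inl (Finset.mem_union_left _ hδ)
  obtain ⟨s, hs, hs1, hs2⟩ := exists_strictBetween_triangle hUD hdisj hE (by omega) hle hadj
    ((strictBetween_iff_below hUD hdisj hlt hle).2 hx)
  obtain ⟨t, ht, ht2, ht1⟩ := exists_strictBetween_triangle hUD hdisj hE hle (by omega) hadj.symm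
    ((strictBetween_iff_above hUD hdisj hlt hle).2 hy)
  have hs := ((strictBetween_iff_below hUD hdisj hlt hle).1 hs).2
  have ht := ((strictBetween_iff_above hUD hdisj hlt hle).1 ht).2
  constructor
  · intro h
    rw [spineSrc_eq hUD hdisj hT hδ hs hs1 hs2, spineTgt_eq hUD hdisj hT hδ ht ht1 ht2] at h
    exact ⟨s, t, hs, ht, hs1, hs2, ht1, ht2, h⟩
  · rintro ⟨s, t, hs, ht, hs1, hs2, ht1, ht2, h⟩
    rwa [spineSrc_eq hUD hdisj hT hδ hs hs1 hs2, spineTgt_eq hUD hdisj hT hδ ht ht1 ht2]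

theorem not_ordered_boundary (hUD : D ∪ U = Finset.Icc 1 (n + 1)) (hdisj : Disjoint D U)
    {E : Finset (ℕ × ℕ)} (hE : E ∈ Tri (· ∈ U) (Finset.range (n + 3))) {δ : ℕ × ℕ}
    (hδ : δ ∈ boundary n D U) : ¬ Ordered (· ∈ U) E δ := by
  rintro ⟨s, t, hs, ht, hs1, -, ht1, -, -⟩
  rcases (mem_boundary_iff hUD hdisj (Finset.mem_filter.1 hδ).1).1 hδ with h | h
  · exact h s (hs1.mem_left hE) hs
  · exact h t (ht1.mem_left hE) ht

theorem card_ordered_arcs (hUD : D ∪ U = Finset.Icc 1 (n + 1)) (hdisj : Disjoint D U)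
    {T : Finset (ℕ × ℕ)} (hT : IsTriangulation n D U T) :
    (T.filter (fun δ => spineSrc n D U T δ < spineTgt n D U T δ)).card =
      ord (· ∈ U) (T ∪ boundary n D U) := by
  rw [ord, ← Finset.card_filter]
  congr 1
  ext δ
  simp only [Finset.mem_filter, Finset.mem_union]
  constructor
  · exact fun h => ⟨Or.inl h.1, (spineSrc_lt_spineTgt_iff hUD hdisj hT h.1).1 h.2⟩
  · rintro ⟨h | h, ho⟩
    · exact ⟨h, (spineSrc_lt_spineTgt_iff hUD hdisj hT h).2 ho⟩
    · exact absurd ho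
        (not_ordered_boundary hUD hdisj (union_boundary_mem_Tri hUD hdisj hT) h)

theorem orderedArcCount_eq (hUD : D ∪ U = Finset.Icc 1 (n + 1)) (hdisj : Disjoint D U) (l : ℕ) :
    orderedArcCount n D U l =
      ((Tri (· ∈ U) (Finset.range (n + 3))).filter (fun E => ord (· ∈ U) E = l)).card := by
  have cancel : ∀ T, IsTriangulation n D U T → (T ∪ boundary n D U) \ boundary n D U = T :=
    fun T hT => Finset.union_sdiff_cancel_right <| Finset.disjoint_left.2
      fun δ hδ => (isInternalDiag_iff.1 (hT.1 δ hδ)).2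
  have cancel' : ∀ E ∈ Tri (· ∈ U) (Finset.range (n + 3)),
      E \ boundary n D U ∪ boundary n D U = E :=
    fun E hE => Finset.sdiff_union_of_subset (boundary_subset hUD hdisj hE)
  refine Finset.card_nbij' (· ∪ boundary n D U) (· \ boundary n D U) ?_ ?_ ?_ ?_
  · intro T h
    simp only [Finset.coe_filter, Set.mem_ofPred_eq, mem_allTri] at h ⊢
    exact ⟨union_boundary_mem_Tri hUD hdisj h.1, by rw [← card_ordered_arcs hUD hdisj h.1, h.2]⟩
  · intro E h
    simp only [Finset.coe_filter, Set.mem_ofPred_eq, mem_allTri] at h ⊢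
    have hT := isTriangulation_sdiff hUD hdisj h.1
    exact ⟨hT, by rw [card_ordered_arcs hUD hdisj hT, cancel' E h.1, h.2]⟩
  · intro T h
    simp only [Finset.coe_filter, Set.mem_ofPred_eq, mem_allTri] at h
    exact cancel T h.1
  · intro E h
    simp only [Finset.coe_filter, Set.mem_ofPred_eq] at h
    exact cancel' E h.1

end Translation

theorem coeff_ordPoly (u : ℕ → Prop) (S : Finset ℕ) (l : ℕ) :
    (ordPoly u S).coeff l = ((Tri u S).filter (fun E => ord u E = l)).card := by
  simp [ordPoly, Polynomial.coeff_X_pow, eq_comm]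

/-- The number of triangulations of `P` whose spine has exactly `ℓ`
ordered arcs equals the Narayana number `(1/(n+1))·C(n+1,ℓ)·C(n+1,ℓ+1)`; in particular
it does not depend on the partition of `[n+1]` into `U` and `D`. -/
theorem narayana_count (n : ℕ) (hn : 1 ≤ n) (D U : Finset ℕ)
    (hUD : D ∪ U = Finset.Icc 1 (n + 1)) (hdisj : Disjoint D U)
    (ℓ : ℕ) (hℓ : ℓ ≤ n) :
    orderedArcCount n D U ℓ * (n + 1) = Nat.choose (n + 1) ℓ * Nat.choose (n + 1) (ℓ + 1) := by
  have h := coeff_narPoly (n + 1) ℓ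
  rw [← ordPoly_eq_narPoly (· ∈ U) (n + 1) (Finset.range (n + 3)) (Finset.card_range _),
    coeff_ordPoly, ← orderedArcCount_eq hUD hdisj, mul_comm] at h
  exact_mod_cast h

end Spines
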